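/- arXiv:1001.0601 — 10 statements merged into one kernel-verified Lean document; each statement's English description precedes it below -/
import Mathlib

section
/- For every infinite group G, the 2-nd Zariski topology 𝔷_{G²[x]} on G is not discrete. -/
open Topology

/-- Evaluation of the monomial `a₀ x^{ε₁} a₁ ⋯ x^{ε_k} a_k` at `g`, where the
monomial is encoded by its first coefficient `a₀` and the list `l = [(ε₁,a₁),…,(ε_k,a_k)]`;
the Boolean `true` stands for the exponent `1` and `false` for `-1`. -/
def mEval {G : Type*} [Group G] (a₀ : G) (l : List (Bool × G)) (g : G) : G :=
  a₀ * (l.map fun p => (if p.1 then g else g⁻¹) * p.2).prod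

/-- The co-zero set `{g ∈ G : w(g) ≠ 1}` of the monomial `w` encoded by `(a₀, l)`. -/
def cozeroSet {G : Type*} [Group G] (a₀ : G) (l : List (Bool × G)) : Set G :=
  {g | mEval a₀ l g ≠ 1}

/-- The `n`-th Zariski topology on a group `G`: the topology generated by the sub-base
of co-zero sets of monomials of degree `≤ n` with coefficients in `G`. -/
def nthZariski (G : Type*) [Group G] (n : ℕ) : TopologicalSpace G :=
  .generateFrom {s | ∃ a₀ l, l.length ≤ n ∧ s = cozeroSet a₀ l}

/-- The Zariski topology on a group `G`: the topology generated by the sub-base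
of co-zero sets of all monomials with coefficients in `G`. -/
def fullZariski (G : Type*) [Group G] : TopologicalSpace G :=
  .generateFrom {s | ∃ a₀ l, s = cozeroSet a₀ l}

/-- The pseudocharacter of a topological space `(X, τ)` at a point `x`: the smallest
cardinality of a family of neighborhoods of `x` whose intersection is `{x}`. -/
noncomputable def pseudoChar {X : Type*} (τ : TopologicalSpace X) (x : X) : Cardinal :=
  ⨅ 𝒰 : {𝒰 : Set (Set X) // (∀ s ∈ 𝒰, s ∈ @nhds X τ x) ∧ ⋂₀ 𝒰 = {x}},
    Cardinal.mk 𝒰.1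

/-- On every group there is an ultrafilter containing no coset of a subgroup of infinite
index which is moreover idempotent for the multiplication of ultrafilters. -/
theorem exists_idempotent_ultrafilter_avoiding_cosets (G : Type*) [Group G] :
    ∃ p : Ultrafilter G,
      (∀ H : Subgroup G, ¬ H.FiniteIndex → ∀ g : G, ¬ ∀ᶠ x in p, g⁻¹ * x ∈ H) ∧
      ∀ P : G → Prop, (∀ᶠ x in p, P x) → ∀ᶠ x in p, ∀ᶠ y in p, P (x * y) := by
  let : Semigroup (Ultrafilter G) := Ultrafilter.semigroup
  let S : Set (Ultrafilter G) :=
    {p | ∀ H : Subgroup G, ¬ H.FiniteIndex → ∀ g : G, ¬ ∀ᶠ x in p, g⁻¹ * x ∈ H}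
  have hclosed : IsClosed S := by
    have hS : S = ⋂ (H : Subgroup G) (_ : ¬ H.FiniteIndex) (g : G),
        {p : Ultrafilter G | {x | g⁻¹ * x ∈ H} ∈ p}ᶜ := by
      ext p
      simp only [S, Set.mem_iInter]
      rfl
    rw [hS]
    exact isClosed_iInter fun H => isClosed_iInter fun _ => isClosed_iInter fun g =>
      (ultrafilter_isOpen_basic _).isClosed_compl
  have hne : S.Nonempty := by
    let C : {H : Subgroup G // ¬ H.FiniteIndex} × G → Set G := fun i => {x | i.2⁻¹ * x ∈ i.1.1}ᶜ
    obtain ⟨p, hp⟩ := Ultrafilter.exists_ultrafilter_of_finite_inter_nonempty (Set.range C) <| by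
      intro T hT
      classical
      obtain ⟨t, rfl⟩ := Finset.subset_set_image_iff.mp (Set.image_univ ▸ hT) |>.imp fun _ h => h.2
      by_contra hempty
      rw [Set.not_nonempty_iff_eq_empty] at hempty
      obtain ⟨i, -, hi⟩ := Subgroup.exists_finiteIndex_of_leftCoset_cover
        (H := fun i : {H : Subgroup G // ¬ H.FiniteIndex} × G => i.1.1) (g := fun i => i.2)
        (s := t) <| by
          refine Set.eq_univ_of_forall fun x => ?_
          have hx : x ∉ ⋂₀ (↑(t.image C) : Set (Set G)) := hempty ▸ Set.notMem_empty x
          rw [Finset.coe_image, Set.sInter_image, Set.mem_iInter₂] at hx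
          push Not at hx
          obtain ⟨i, hi, hx⟩ := hx
          exact Set.mem_iUnion₂_of_mem hi ((mem_leftCoset_iff _).mpr (not_not.mp hx))
      exact i.1.2 hi
    exact ⟨p, fun H hH g => Ultrafilter.compl_mem_iff_notMem.mp (hp ⟨(⟨H, hH⟩, g), rfl⟩)⟩
  obtain ⟨p, hp, hpp⟩ := exists_idempotent_in_compact_subsemigroup
    Ultrafilter.continuous_mul_left S hne hclosed.isCompact <| by
      intro p _ q hq H hH g h
      obtain ⟨x, hx⟩ := ((Ultrafilter.eventually_mul p q _).mp h).exists
      exact hq H hH (x⁻¹ * g) (by simpa [mul_assoc] using hx)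
  exact ⟨p, hp, fun P hP => (Ultrafilter.eventually_mul p p P).mp (hpp.symm ▸ hP)⟩

section

variable {G : Type*} [Group G] {p : Ultrafilter G}

/-- An idempotent ultrafilter contains every subgroup of finite index. -/
theorem eventually_mem_of_finiteIndex
    (hmul : ∀ P : G → Prop, (∀ᶠ x in p, P x) → ∀ᶠ x in p, ∀ᶠ y in p, P (x * y))
    (H : Subgroup G) [H.FiniteIndex] : ∀ᶠ x in p, x ∈ H := by
  obtain ⟨q, hq⟩ := (p.map (QuotientGroup.mk : G → G ⧸ H.normalCore)).eq_pure_of_finite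
  have hq' : ∀ᶠ x in p, QuotientGroup.mk (s := H.normalCore) x = q := by
    have h : {q} ∈ p.map (QuotientGroup.mk : G → G ⧸ H.normalCore) := by simp [hq]
    exact h
  obtain ⟨x, hx, hxy⟩ := (hq'.and (hmul _ hq')).exists
  obtain ⟨y, hy, hxy⟩ := (hq'.and hxy).exists
  have hq1 : q = 1 := by
    rw [QuotientGroup.mk_mul, hx, hy] at hxy
    exact mul_eq_left.mp hxy
  filter_upwards [hq'] with x hx
  exact H.normalCore_le ((QuotientGroup.eq_one_iff x).mp (hx.trans hq1))

variable (hcoset : ∀ (H : Subgroup G) (g : G), (∀ᶠ x in p, g⁻¹ * x ∈ H) → ∀ᶠ x in p, x ∈ H)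
include hcoset

theorem eq_one_of_eventually_eq {g : G} (h : ∀ᶠ x in p, x = g) : g = 1 := by
  obtain ⟨x, hx, hx'⟩ := (h.and (hcoset ⊥ g (h.mono fun x hx => by simp [hx]))).exists
  exact hx ▸ Subgroup.mem_bot.mp hx'

theorem eq_of_eventually_conj_eq {z w : G} (h : ∀ᶠ y in p, y * z = w * y) : z = w := by
  obtain ⟨y₀, hy₀⟩ := h.exists
  have hc := hcoset (Subgroup.centralizer {z}) y₀ <| h.mono fun y hy => by
    rw [Subgroup.mem_centralizer_singleton_iff]
    have hw : w = y₀ * z * y₀⁻¹ := by rw [hy₀]; group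
    rw [mul_assoc, hy, hw]
    group
  obtain ⟨y, hy, hy'⟩ := (h.and hc).exists
  rw [Subgroup.mem_centralizer_singleton_iff] at hy'
  exact mul_right_cancel (hy'.symm.trans hy)

variable (hmul : ∀ P : G → Prop, (∀ᶠ x in p, P x) → ∀ᶠ x in p, ∀ᶠ y in p, P (x * y))
include hmul

theorem eq_of_eventually_mul_mul_eq {b d : G} (h : ∀ᶠ x in p, x * b * x = d) : b = d := by
  obtain ⟨x, hx, hxy⟩ := (h.and (hmul _ h)).exists
  have hconj : b * x * b⁻¹ = x⁻¹ := eq_of_eventually_conj_eq hcoset <| by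
    filter_upwards [h, hxy] with y hy hxy
    have hyb : x * y * b * x = y * b := mul_right_cancel (b := y) (by
      rw [hy, ← hxy]; group)
    calc y * (b * x * b⁻¹) = x⁻¹ * (x * y * b * x) * b⁻¹ := by group
      _ = x⁻¹ * y := by rw [hyb]; group
  calc b = x * (x⁻¹) * b := by group
    _ = x * b * x := by rw [← hconj]; group
    _ = d := hx

/-- A monomial of degree at most `2` that is generically trivial is trivial at `1`. -/
theorem mEval_one_of_eventually {a₀ : G} {l : List (Bool × G)} (hl : l.length ≤ 2)
    (h : ∀ᶠ x in p, mEval a₀ l x = 1) : mEval a₀ l 1 = 1 := by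
  match l, hl with
  | [], _ => simpa [mEval] using h
  | [(true, a)], _ =>
    have ha : a₀⁻¹ * a⁻¹ = 1 := eq_one_of_eventually_eq hcoset <| h.mono fun x hx => by
      simp only [mEval, List.map_cons, List.map_nil, List.prod_cons, List.prod_nil, if_true] at hx
      rw [← mul_one a₀⁻¹, ← hx]; group
    have ha' : a = a₀⁻¹ := (eq_of_mul_inv_eq_one ha).symm
    simp [mEval, ha']
  | [(false, a)], _ =>
    have ha : a * a₀ = 1 := eq_one_of_eventually_eq hcoset <| h.mono fun x hx => by
      simp only [mEval, List.map_cons, List.map_nil, List.prod_cons, List.prod_nil,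
        Bool.false_eq_true, if_false] at hx
      calc x = a * (a₀ * (x⁻¹ * a * 1))⁻¹ * a₀ := by group
        _ = a * a₀ := by rw [hx]; group
    simp [mEval, mul_eq_one_comm.mp ha]
  | [(true, a), (true, b)], _ =>
    have ha : a = a₀⁻¹ * b⁻¹ := eq_of_eventually_mul_mul_eq hcoset hmul <| h.mono fun x hx => by
      simp only [mEval, List.map_cons, List.map_nil, List.prod_cons, List.prod_nil, if_true] at hx
      rw [← mul_one a₀⁻¹, ← hx]; group
    simp [mEval, ha]
  | [(true, a), (false, b)], _ =>
    have ha : a = a₀⁻¹ * b⁻¹ := eq_of_eventually_conj_eq hcoset <| h.mono fun x hx => by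
      simp only [mEval, List.map_cons, List.map_nil, List.prod_cons, List.prod_nil, if_true,
        Bool.false_eq_true, if_false] at hx
      rw [← mul_one a₀⁻¹, ← hx]; group
    simp [mEval, ha]
  | [(false, a), (true, b)], _ =>
    have ha : a₀⁻¹ * b⁻¹ = a := eq_of_eventually_conj_eq hcoset <| h.mono fun x hx => by
      simp only [mEval, List.map_cons, List.map_nil, List.prod_cons, List.prod_nil, if_true,
        Bool.false_eq_true, if_false] at hx
      rw [← mul_one a₀⁻¹, ← hx]; group
    simp [mEval, ← ha]
  | [(false, a), (false, b)], _ =>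
    have ha : a⁻¹ = b * a₀ := eq_of_eventually_mul_mul_eq hcoset hmul <| h.mono fun x hx => by
      simp only [mEval, List.map_cons, List.map_nil, List.prod_cons, List.prod_nil,
        Bool.false_eq_true, if_false] at hx
      calc x * a⁻¹ * x = b * (a₀ * (x⁻¹ * a * (x⁻¹ * b * 1)))⁻¹ * a₀ := by group
        _ = b * a₀ := by rw [hx]; group
    rw [inv_eq_iff_eq_inv] at ha
    simp [mEval, ha]

/-- Such an ultrafilter converges to `1` in the second Zariski topology. -/
theorem le_nhds_one_secondZariski : (p : Filter G) ≤ @nhds G (nthZariski G 2) 1 := by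
  rw [nthZariski, TopologicalSpace.nhds_generateFrom]
  refine le_iInf₂ ?_
  rintro _ ⟨h1, a₀, l, hl, rfl⟩
  rw [Filter.le_principal_iff]
  by_contra hmem
  refine h1 (mEval_one_of_eventually hcoset hmul hl ?_)
  have h := Ultrafilter.compl_mem_iff_notMem.mpr hmem
  filter_upwards [h] with x hx
  exact not_not.mp hx

end

/-- For every infinite group `G`, the 2-nd Zariski topology on `G` is not discrete. -/
theorem secondZariski_not_discrete {G : Type*} [Group G] [Infinite G] :
    nthZariski G 2 ≠ ⊥ := by
  intro hbot
  obtain ⟨p, havoid, hmul⟩ := exists_idempotent_ultrafilter_avoiding_cosets G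
  have hcoset : ∀ (H : Subgroup G) (g : G), (∀ᶠ x in p, g⁻¹ * x ∈ H) → ∀ᶠ x in p, x ∈ H := by
    intro H g h
    have : H.FiniteIndex := by
      by_contra hH
      exact havoid H hH g h
    exact eventually_mem_of_finiteIndex hmul H
  have hle := le_nhds_one_secondZariski hcoset hmul
  rw [hbot] at hle
  have hone : ∀ᶠ x in p, x = (1 : G) := hle (by
    let : TopologicalSpace G := ⊥
    have : DiscreteTopology G := ⟨rfl⟩
    simp [nhds_discrete])
  refine havoid ⊥ ?_ 1 (hone.mono fun x hx => by simp [hx])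
  intro hfin
  exact hfin.index_ne_zero (by rw [Subgroup.index_bot, Nat.card_eq_zero_of_infinite])
end

section
/- Let G be an infinite group. Suppose we are given a finite family of triples (aᵢ,bᵢ,εᵢ) ∈ G×G×{−1,1} with aᵢbᵢ ≠ 1 for every i, and a finite family of quintuples (cⱼ,dⱼ,eⱼ,δⱼ,ηⱼ) ∈ G×G×G×{−1,1}×{−1,1} with cⱼdⱼeⱼ ≠ 1 for every j. Then there exists x ∈ G with x ≠ 1 such that aᵢx^{εᵢ}bᵢ ≠ 1 for every i and cⱼx^{δⱼ}dⱼx^{ηⱼ}eⱼ ≠ 1 for every j. (Equivalently, 1 is not an isolated point of G in the 2-nd Zariski topology.) -/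
open Filter in
attribute [local instance] Ultrafilter.mul Ultrafilter.semigroup in
/-- An infinite group carries a nonprincipal idempotent ultrafilter. -/
theorem exists_idempotent_ultrafilter_le_cofinite (G : Type*) [Group G] [Infinite G] :
    ∃ U : Ultrafilter G, (U : Filter G) ≤ cofinite ∧ U * U = U := by
  refine exists_idempotent_in_compact_subsemigroup Ultrafilter.continuous_mul_left
    {U : Ultrafilter G | (U : Filter G) ≤ cofinite} ⟨hyperfilter G, hyperfilter_le_cofinite⟩ ?_ ?_
  · refine IsClosed.isCompact ?_
    have h : {U : Ultrafilter G | (U : Filter G) ≤ cofinite} =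
        ⋂ s ∈ (cofinite : Filter G), {U : Ultrafilter G | s ∈ U} := by
      ext U
      simp [Filter.le_def]
    rw [h]
    exact isClosed_biInter fun s _ => ultrafilter_isClosed_basic s
  · intro U _ V hV
    refine le_cofinite_iff_eventually_ne.mpr fun x => ?_
    rw [Ultrafilter.eventually_mul]
    refine Eventually.of_forall fun u => ?_
    filter_upwards [le_cofinite_iff_eventually_ne.mp hV (u⁻¹ * x)] with v hv huv
    exact hv (eq_inv_mul_of_mul_eq huv)

open Filter in
attribute [local instance] Ultrafilter.mul in
/-- Large sets of an idempotent ultrafilter contain all finite products of some triple. -/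
theorem Ultrafilter.exists_finite_products_of_eventually {M : Type*} [Semigroup M]
    {U : Ultrafilter M} (hU : U * U = U) {p : M → Prop} (hp : ∀ᶠ x in U, p x) :
    ∃ u v w : M, p u ∧ p v ∧ p w ∧ p (u * v) ∧ p (u * w) ∧ p (v * w) ∧ p (u * v * w) := by
  have key {q : M → Prop} (hq : ∀ᶠ x in U, q x) : ∀ᶠ x in U, ∀ᶠ y in U, q (x * y) := by
    rwa [← Ultrafilter.eventually_mul, hU]
  have h₂ := key hp
  obtain ⟨u, hu, huv, huvw⟩ := (hp.and (h₂.and (key h₂))).exists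
  obtain ⟨v, hv, huv', hvw, huvw'⟩ := (hp.and (huv.and (h₂.and huvw))).exists
  obtain ⟨w, hw, huw, hvw', huvw''⟩ := (hp.and (huv.and (hvw.and huvw'))).exists
  exact ⟨u, v, w, hu, hv, hw, huv', huw, hvw', huvw''⟩

section Monomials

variable {G : Type*} [Group G]

/-- If `u`, `v` and `u * v` solve `x * d * x = g`, then conjugation by `v` multiplies `u`
by `g⁻¹ * d`. -/
theorem inv_mul_mul_eq_of_mul_mul_self_eq {d g u v : G} (hu : u * d * u = g)
    (hv : v * d * v = g) (huv : u * v * d * (u * v) = g) : v⁻¹ * u * v = g⁻¹ * d * u := by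
  have h : u * g * (v⁻¹ * u * v) = u * d * u := by
    calc u * g * (v⁻¹ * u * v) = u * (v * d * v) * (v⁻¹ * u * v) := by rw [hv]
      _ = u * v * d * (u * v) := by group
      _ = u * d * u := huv.trans hu.symm
  calc v⁻¹ * u * v = (u * g)⁻¹ * (u * g * (v⁻¹ * u * v)) := by group
    _ = g⁻¹ * d * u := by rw [h]; group

theorem eq_of_mul_mul_self_eq {d g u v w : G} (hu : u * d * u = g) (hv : v * d * v = g)
    (hw : w * d * w = g) (huv : u * v * d * (u * v) = g) (huw : u * w * d * (u * w) = g)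
    (hvw : v * w * d * (v * w) = g) (huvw : u * v * w * d * (u * v * w) = g) : d = g := by
  have h₁ := inv_mul_mul_eq_of_mul_mul_self_eq hu hv huv
  have h₂ := inv_mul_mul_eq_of_mul_mul_self_eq hu hw huw
  have h₃ := inv_mul_mul_eq_of_mul_mul_self_eq hu hvw (by simpa only [mul_assoc] using huvw)
  have h : w⁻¹ * (g⁻¹ * d) * w * (g⁻¹ * d * u) = g⁻¹ * d * u := by
    calc w⁻¹ * (g⁻¹ * d) * w * (g⁻¹ * d * u) =
          w⁻¹ * (g⁻¹ * d) * w * (w⁻¹ * u * w) := by rw [h₂]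
      _ = w⁻¹ * (g⁻¹ * d * u) * w := by group
      _ = (v * w)⁻¹ * u * (v * w) := by rw [← h₁]; group
      _ = g⁻¹ * d * u := h₃
  have hconj : w⁻¹ * (g⁻¹ * d) * w⁻¹⁻¹ = 1 := by
    rw [inv_inv]
    exact mul_eq_right.mp h
  exact (inv_mul_eq_one.mp (conj_eq_one_iff.mp hconj)).symm

theorem eq_of_conj_eq {d g u v : G} (hu : u * d * u⁻¹ = g) (hv : v * d * v⁻¹ = g)
    (huv : u * v * d * (u * v)⁻¹ = g) : d = g := by
  have h : u * g * u⁻¹ = g := by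
    calc u * g * u⁻¹ = u * (v * d * v⁻¹) * u⁻¹ := by rw [hv]
      _ = u * v * d * (u * v)⁻¹ := by group
      _ = g := huv
  simpa using hu.trans h.symm

variable {U : Ultrafilter G}

open Filter

attribute [local instance] Ultrafilter.mul

theorem Ultrafilter.eventually_mul_mul_self_ne (hU : U * U = U) {d g : G} (h : d ≠ g) :
    ∀ᶠ x in U, x * d * x ≠ g := by
  by_contra hne
  obtain ⟨u, v, w, hu, hv, hw, huv, huw, hvw, huvw⟩ :=
    exists_finite_products_of_eventually hU (by simpa using hne)
  exact h (eq_of_mul_mul_self_eq hu hv hw huv huw hvw huvw)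

theorem Ultrafilter.eventually_conj_ne (hU : U * U = U) {d g : G} (h : d ≠ g) :
    ∀ᶠ x in U, x * d * x⁻¹ ≠ g := by
  by_contra hne
  obtain ⟨u, v, _, hu, hv, _, huv, _⟩ :=
    exists_finite_products_of_eventually hU (p := fun x => x * d * x⁻¹ = g) (by simpa using hne)
  exact h (eq_of_conj_eq hu hv huv)

/-- A monomial of degree two that does not vanish at `1` does not vanish on a large set. -/
theorem Ultrafilter.eventually_monomial_ne_one (hU : U * U = U) {c d e : G} (δ η : Bool)
    (h : c * d * e ≠ 1) :
    ∀ᶠ x in U, c * (if δ then x else x⁻¹) * d * (if η then x else x⁻¹) * e ≠ 1 := by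
  have hd : d ≠ c⁻¹ * e⁻¹ := by
    rintro rfl
    simp at h
  have solve {y z : G} (hx : c * y * d * z * e = 1) : y * d * z = c⁻¹ * e⁻¹ := by
    rw [← eq_inv_of_mul_eq_one_left hx]
    group
  cases δ <;> cases η
  · filter_upwards [eventually_mul_mul_self_ne hU (inv_injective.ne hd)] with x hx hx'
    refine hx ?_
    rw [← solve hx']
    simp [mul_assoc]
  · filter_upwards [eventually_conj_ne hU hd.symm] with x hx hx'
    refine hx ?_
    rw [← solve hx']
    simp [mul_assoc]
  · filter_upwards [eventually_conj_ne hU hd] with x hx hx'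
    exact hx (solve hx')
  · filter_upwards [eventually_mul_mul_self_ne hU hd] with x hx hx'
    exact hx (solve hx')

end Monomials


/-- The identity is not isolated in the second Zariski topology: given finitely many
monomials of degree `≤ 2` that do not vanish at `1`, some `x ≠ 1` lies in all of
their co-zero sets.  Here `true` encodes the exponent `1` and `false` the exponent `-1`. -/
theorem exists_ne_one_nonvanishing {G : Type*} [Group G] [Infinite G]
    {ι κ : Type*} [Finite ι] [Finite κ]
    (a b : ι → G) (ε : ι → Bool)
    (c d e : κ → G) (δ η : κ → Bool)
    (hab : ∀ i, a i * b i ≠ 1)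
    (hcde : ∀ j, c j * d j * e j ≠ 1) :
    ∃ x : G, x ≠ 1 ∧
      (∀ i, a i * (if ε i then x else x⁻¹) * b i ≠ 1) ∧
      (∀ j, c j * (if δ j then x else x⁻¹) * d j * (if η j then x else x⁻¹) * e j ≠ 1) := by
  obtain ⟨U, hcof, hU⟩ := exists_idempotent_ultrafilter_le_cofinite G
  have hne := Filter.le_cofinite_iff_eventually_ne.mp hcof
  have hlin (i : ι) : ∀ᶠ x in (U : Filter G), a i * (if ε i then x else x⁻¹) * b i ≠ 1 := by
    filter_upwards [hne ((a i)⁻¹ * (b i)⁻¹), hne ((a i)⁻¹ * (b i)⁻¹)⁻¹] with x hx hx' h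
    have h' : (if ε i then x else x⁻¹) = (a i)⁻¹ * (b i)⁻¹ := by
      rw [← eq_inv_of_mul_eq_one_left h]
      group
    split_ifs at h'
    · exact hx h'
    · exact hx' (inv_eq_iff_eq_inv.mp h')
  have hquad (j : κ) := Ultrafilter.eventually_monomial_ne_one hU (δ j) (η j) (hcde j)
  exact ((hne 1).and ((Filter.eventually_all.mpr hlin).and
    (Filter.eventually_all.mpr hquad))).exists
end

section
/- For every infinite group G and every finite family 𝒰 of neighborhoods of the identity 1 in the 2-nd Zariski topology 𝔷_{G²[x]}, the intersection ⋂𝒰 is not equal to {1}. (That is, the pseudocharacter of (G, 𝔷_{G²[x]}) at 1 is at least ℵ₀.) -/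
open Topology

namespace SecondZariski

open Filter
open scoped Pointwise

section Group

variable {G : Type*} [Group G]

/-- The subgroup of elements with finitely many conjugates. -/
def fcCenter (G : Type*) [Group G] : Subgroup G where
  carrier := {g | (Subgroup.centralizer {g}).FiniteIndex}
  one_mem' := by
    have h : (⊤ : Subgroup G) ≤ Subgroup.centralizer {1} := fun k _ => by
      simp [Subgroup.mem_centralizer_singleton_iff]
    exact Subgroup.finiteIndex_of_le h
  mul_mem' := by
    intro a b (ha : (Subgroup.centralizer {a}).FiniteIndex)
      (hb : (Subgroup.centralizer {b}).FiniteIndex)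
    have h : Subgroup.centralizer {a} ⊓ Subgroup.centralizer {b} ≤
        Subgroup.centralizer {a * b} := by
      intro k hk
      obtain ⟨hka, hkb⟩ := Subgroup.mem_inf.1 hk
      rw [Subgroup.mem_centralizer_singleton_iff] at hka hkb
      rw [Subgroup.mem_centralizer_singleton_iff]
      exact Commute.mul_right hka hkb
    exact Subgroup.finiteIndex_of_le h
  inv_mem' := by
    intro a (ha : (Subgroup.centralizer {a}).FiniteIndex)
    have h : Subgroup.centralizer {a} ≤ Subgroup.centralizer {a⁻¹} := by
      intro k hk
      rw [Subgroup.mem_centralizer_singleton_iff] at hk ⊢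
      exact Commute.inv_right hk
    exact Subgroup.finiteIndex_of_le h

lemma mem_fcCenter_iff {g : G} :
    g ∈ fcCenter G ↔ (Subgroup.centralizer {g}).FiniteIndex :=
  Iff.rfl

instance fcCenter_normal : (fcCenter G).Normal where
  conj_mem n hn g := by
    rw [mem_fcCenter_iff] at hn ⊢
    have hindex : ((Subgroup.centralizer {n}).comap
        (MulAut.conj g⁻¹).toMonoidHom).FiniteIndex := by
      rw [Subgroup.finiteIndex_iff,
        Subgroup.index_comap_of_surjective _ (MulAut.conj g⁻¹).surjective]
      exact hn.index_ne_zero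
    have hle : (Subgroup.centralizer {n}).comap (MulAut.conj g⁻¹).toMonoidHom ≤
        Subgroup.centralizer {g * n * g⁻¹} := by
      intro k hk
      rw [Subgroup.mem_comap, Subgroup.mem_centralizer_singleton_iff] at hk
      rw [Subgroup.mem_centralizer_singleton_iff]
      simp only [MulEquiv.coe_toMonoidHom, MulAut.conj_apply, inv_inv] at hk
      calc k * (g * n * g⁻¹) = g * (g⁻¹ * k * g * n) * g⁻¹ := by group
        _ = g * (n * (g⁻¹ * k * g)) * g⁻¹ := by rw [hk]
        _ = g * n * g⁻¹ * k := by group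
    exact Subgroup.finiteIndex_of_le hle

/-- A set covered by finitely many left cosets of subgroups of infinite index. -/
def IsSmall (S : Set G) : Prop :=
  ∃ s : Finset (G × Subgroup G), (∀ q ∈ s, ¬ q.2.FiniteIndex) ∧
    S ⊆ ⋃ q ∈ s, q.1 • (q.2 : Set G)

lemma IsSmall.mono {S T : Set G} (hT : IsSmall T) (h : S ⊆ T) : IsSmall S :=
  let ⟨s, hs, hTs⟩ := hT
  ⟨s, hs, h.trans hTs⟩

lemma isSmall_empty : IsSmall (∅ : Set G) :=
  ⟨∅, by simp, by simp⟩

lemma IsSmall.union {S T : Set G} (hS : IsSmall S) (hT : IsSmall T) : IsSmall (S ∪ T) := by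
  classical
  obtain ⟨s, hs, hSs⟩ := hS
  obtain ⟨t, ht, hTt⟩ := hT
  refine ⟨s ∪ t, fun q hq => (Finset.mem_union.1 hq).elim (hs q) (ht q), ?_⟩
  rw [Finset.set_biUnion_union]
  exact Set.union_subset_union hSs hTt

lemma isSmall_leftCoset {K : Subgroup G} (hK : ¬ K.FiniteIndex) (g : G) :
    IsSmall (g • (K : Set G)) :=
  ⟨{(g, K)}, by simpa using hK, by simp⟩

lemma not_isSmall_of_finiteIndex (K : Subgroup G) [K.FiniteIndex] : ¬ IsSmall (K : Set G) := by
  rintro ⟨s, hs, hKs⟩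
  obtain ⟨t, -, ht⟩ := Subgroup.exists_leftTransversal_of_FiniteIndex (le_top : K ≤ ⊤)
  have hcover : ⋃ i ∈ t ×ˢ s, ((i.1 : G) * i.2.1) • (i.2.2 : Set G) = Set.univ := by
    refine Set.eq_univ_of_forall fun x => ?_
    have hx : x ∈ ⋃ g ∈ t, (g : G) • (K : Set G) := by rw [ht]; trivial
    simp only [Set.mem_iUnion, mem_leftCoset_iff] at hx
    obtain ⟨g, hg, hxg⟩ := hx
    have hxs := hKs hxg
    simp only [Set.mem_iUnion, mem_leftCoset_iff] at hxs
    obtain ⟨q, hq, hxq⟩ := hxs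
    simp only [Set.mem_iUnion, mem_leftCoset_iff]
    exact ⟨(g, q), Finset.mk_mem_product hg hq, by simpa [mul_assoc] using hxq⟩
  obtain ⟨i, hi, hfin⟩ := Subgroup.exists_finiteIndex_of_leftCoset_cover hcover
  exact hs _ (Finset.mem_product.1 hi).2 hfin

variable (G) in
/-- The filter generated by the subgroups of finite index and the complements of the cosets of
subgroups of infinite index. -/
def genericFilter : Filter G where
  sets := {S | ∃ K : Subgroup G, K.FiniteIndex ∧ IsSmall ((K : Set G) \ S)}
  univ_sets := ⟨⊤, inferInstance, by simpa using isSmall_empty⟩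
  sets_of_superset := fun ⟨K, hK, h⟩ hST => ⟨K, hK, h.mono (Set.sdiff_subset_sdiff_right hST)⟩
  inter_sets := by
    rintro S T ⟨K, hK, hS⟩ ⟨L, hL, hT⟩
    refine ⟨K ⊓ L, inferInstance, (hS.union hT).mono ?_⟩
    rintro x ⟨⟨hxK, hxL⟩, hx⟩
    by_cases hxS : x ∈ S
    · exact Or.inr ⟨hxL, fun hxT => hx ⟨hxS, hxT⟩⟩
    · exact Or.inl ⟨hxK, hxS⟩

instance genericFilter_neBot : (genericFilter G).NeBot := by
  rw [← Filter.empty_mem_iff_bot.not.trans Filter.neBot_iff.symm]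
  rintro ⟨K, hK, h⟩
  exact not_isSmall_of_finiteIndex K (by simpa using h)

/-- An ultrafilter containing every subgroup of finite index and no coset of a subgroup of
infinite index. -/
structure IsGeneric (p : Ultrafilter G) : Prop where
  mem_of_finiteIndex : ∀ K : Subgroup G, K.FiniteIndex → ∀ᶠ x in (p : Filter G), x ∈ K
  eventually_notMem : ∀ K : Subgroup G, ¬ K.FiniteIndex → ∀ g : G,
    ∀ᶠ x in (p : Filter G), g * x ∉ K

lemma exists_isGeneric (G : Type*) [Group G] : ∃ p : Ultrafilter G, IsGeneric p := by
  refine ⟨Ultrafilter.of (genericFilter G), fun K hK => ?_, fun K hK g => ?_⟩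
  · exact Ultrafilter.of_le _ ⟨K, hK, isSmall_empty.mono fun x hx => hx.2 hx.1⟩
  · refine Ultrafilter.of_le _ ⟨⊤, inferInstance, (isSmall_leftCoset hK g⁻¹).mono fun x hx => ?_⟩
    rw [mem_leftCoset_iff, inv_inv]
    exact not_not.1 hx.2

lemma exists_eventually_inv_mul_mem (p : Ultrafilter G) {t : Set (Set G)} (ht : t.Finite)
    (hcover : ∀ g, ∃ Z ∈ t, g ∈ Z) :
    ∃ Z ∈ t, ∀ᶠ x in (p : Filter G), ∀ᶠ y in (p : Filter G), x⁻¹ * y ∈ Z := by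
  rw [← Ultrafilter.eventually_exists_mem_iff ht]
  refine Eventually.of_forall fun x => ?_
  rw [← Ultrafilter.eventually_exists_mem_iff ht]
  exact Eventually.of_forall fun y => hcover _

lemma IsGeneric.eventually_mul_ne [Infinite G] {p : Ultrafilter G} (hp : IsGeneric p) (a c : G) :
    ∀ᶠ y in (p : Filter G), a * y ≠ c := by
  have hbot : ¬ (⊥ : Subgroup G).FiniteIndex := by
    rw [Subgroup.not_finiteIndex_iff, Subgroup.index_bot, Nat.card_eq_zero_of_infinite]
  filter_upwards [hp.eventually_notMem ⊥ hbot (c⁻¹ * a)] with y hy h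
  exact hy (by rw [Subgroup.mem_bot, mul_assoc, h, inv_mul_cancel])

lemma IsGeneric.eventually_conj_ne {p : Ultrafilter G} (hp : IsGeneric p) {t : G}
    (ht : t ∉ fcCenter G) (a u : G) :
    ∀ᶠ z in (p : Filter G), (a * z) * t * (a * z)⁻¹ ≠ u := by
  by_cases h : ∃ v, v * t * v⁻¹ = u
  · obtain ⟨v, rfl⟩ := h
    filter_upwards [hp.eventually_notMem _ ht (v⁻¹ * a)] with z hz hconj
    refine hz (Subgroup.mem_centralizer_singleton_iff.2 ?_)
    calc v⁻¹ * a * z * t = v⁻¹ * ((a * z) * t * (a * z)⁻¹) * (a * z) := by group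
      _ = v⁻¹ * (v * t * v⁻¹) * (a * z) := by rw [hconj]
      _ = t * (v⁻¹ * a * z) := by group
  · exact Eventually.of_forall fun z hz => h ⟨_, hz⟩

lemma IsGeneric.not_eventually_eq [Infinite G] {p : Ultrafilter G} (hp : IsGeneric p) (c : G) :
    ¬ ∀ᶠ x in (p : Filter G), ∀ᶠ y in (p : Filter G), x⁻¹ * y = c := by
  intro h
  obtain ⟨x, hx⟩ := h.exists
  obtain ⟨y, hy, hne⟩ := (hx.and (hp.eventually_mul_ne x⁻¹ c)).exists
  exact hne hy

lemma IsGeneric.not_eventually_conj_eq {p : Ultrafilter G} (hp : IsGeneric p) {b d : G}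
    (hbd : b ≠ d) :
    ¬ ∀ᶠ x in (p : Filter G), ∀ᶠ y in (p : Filter G),
      (x⁻¹ * y) * b * (x⁻¹ * y)⁻¹ = d := by
  intro h
  by_cases hb : b ∈ fcCenter G
  · have hC := hp.mem_of_finiteIndex _ hb
    obtain ⟨x, hx, hxb⟩ := (h.and hC).exists
    obtain ⟨y, hy, hyb⟩ := (hx.and hC).exists
    have hu := Subgroup.mem_centralizer_singleton_iff.1 (mul_mem (inv_mem hxb) hyb)
    rw [hu, mul_inv_cancel_right] at hy
    exact hbd hy
  · obtain ⟨x, hx⟩ := h.exists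
    obtain ⟨y, hy, hne⟩ := (hx.and (hp.eventually_conj_ne hb x⁻¹ d)).exists
    exact hne hy

lemma conj_eq_of_mul_mul_eq {u v b d : G} (hv : v * b * v = d)
    (huv : (u * v) * b * (u * v) = d) : v * (d⁻¹ * u⁻¹ * d) * v⁻¹ = u := by
  have h : u * v * b * u = v * b := mul_right_cancel (b := v) (by rw [hv, ← huv]; group)
  calc v * (d⁻¹ * u⁻¹ * d) * v⁻¹ = v * (d⁻¹ * u⁻¹ * (v * b * v)) * v⁻¹ := by rw [hv]
    _ = v * d⁻¹ * u⁻¹ * (v * b) := by group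
    _ = v * d⁻¹ * u⁻¹ * (u * v * b * u) := by rw [h]
    _ = v * (v * b * v)⁻¹ * v * b * u := by rw [hv]; group
    _ = u := by group

lemma eq_of_commute_of_mul_mul_eq {u v b d : G} (hc : Commute u v) (hu : u * b * u = d)
    (hv : v * b * v = d) (huv : (u * v) * b * (u * v) = d) : b = d := by
  have h : u * d * u = u * b * u := by
    calc u * d * u = u * v * b * (v * u) := by rw [← hv]; group
      _ = u * b * u := by rw [← hc.eq, huv, hu]
  exact (mul_left_cancel (mul_right_cancel h)).symm

lemma IsGeneric.not_eventually_mul_mul_eq {p : Ultrafilter G} (hp : IsGeneric p) {b d : G}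
    (hbd : b ≠ d) :
    ¬ ∀ᶠ x in (p : Filter G), ∀ᶠ y in (p : Filter G),
      (x⁻¹ * y) * b * (x⁻¹ * y) = d := by
  intro h
  have hmul (x y z : G) : x⁻¹ * y * (y⁻¹ * z) = x⁻¹ * z := by group
  by_cases hfc : (fcCenter G).FiniteIndex
  · have hFC := hp.mem_of_finiteIndex _ hfc
    obtain ⟨x, hx, hxF⟩ := (h.and hFC).exists
    have hCx := hp.mem_of_finiteIndex _ hxF
    obtain ⟨y, hxy, hy, hyF, hyx⟩ := (hx.and (h.and (hFC.and hCx))).exists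
    have hCy := hp.mem_of_finiteIndex _ hyF
    obtain ⟨z, hxz, hyz, hzx, hzy⟩ := (hx.and (hy.and (hCx.and hCy))).exists
    rw [Subgroup.mem_centralizer_singleton_iff] at hyx hzx hzy
    have hyx : Commute y x := hyx
    have hzx : Commute z x := hzx
    have hzy : Commute z y := hzy
    have hc : Commute (x⁻¹ * y) (y⁻¹ * z) :=
      (hyx.symm.inv_inv.mul_right hzx.symm.inv_left).mul_left
        ((Commute.refl y).inv_right.mul_right hzy.symm)
    exact hbd (eq_of_commute_of_mul_mul_eq hc hxy hyz (by rwa [hmul]))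
  · obtain ⟨x, hx⟩ := h.exists
    obtain ⟨y, hxy, hy, hu⟩ :=
      (hx.and (h.and (hp.eventually_notMem _ hfc x⁻¹))).exists
    have ht : d⁻¹ * (x⁻¹ * y)⁻¹ * d ∉ fcCenter G := by
      intro ht
      have := fcCenter_normal.conj_mem _ ht d
      refine hu (inv_mem_iff.1 ?_)
      convert this using 1
      group
    obtain ⟨z, hxz, hyz, hne⟩ :=
      (hx.and (hy.and (hp.eventually_conj_ne ht y⁻¹ (x⁻¹ * y)))).exists
    exact hne (conj_eq_of_mul_mul_eq hyz (by rwa [hmul]))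

lemma IsGeneric.not_eventually_notMem_cozeroSet [Infinite G] {p : Ultrafilter G}
    (hp : IsGeneric p) {a₀ : G} {l : List (Bool × G)} (hl : l.length ≤ 2)
    (h1 : 1 ∈ cozeroSet a₀ l) :
    ¬ ∀ᶠ x in (p : Filter G), ∀ᶠ y in (p : Filter G), x⁻¹ * y ∉ cozeroSet a₀ l := by
  suffices ∃ Q : G → Prop, (∀ g, g ∉ cozeroSet a₀ l → Q g) ∧
      ¬ ∀ᶠ x in (p : Filter G), ∀ᶠ y in (p : Filter G), Q (x⁻¹ * y) by
    obtain ⟨Q, hQ, hnot⟩ := this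
    exact fun h => hnot (h.mono fun x hx => hx.mono fun y hy => hQ _ hy)
  simp only [cozeroSet, Set.mem_ofPred_eq, not_not] at h1 ⊢
  match l, hl with
  | [], _ =>
    refine ⟨fun _ => False, fun g hg => h1 (by simpa [mEval] using hg), by simp [p.neBot.ne]⟩
  | [(true, a)], _ =>
    refine ⟨(· = a₀⁻¹ * a⁻¹), fun g hg => ?_, hp.not_eventually_eq _⟩
    simp only [mEval, List.map_cons, List.map_nil, List.prod_cons, List.prod_nil, if_true,
      mul_one] at hg
    calc g = a₀⁻¹ * (a₀ * (g * a)) * a⁻¹ := by group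
      _ = a₀⁻¹ * a⁻¹ := by rw [hg, mul_one]
  | [(false, a)], _ =>
    refine ⟨(· = a * a₀), fun g hg => ?_, hp.not_eventually_eq _⟩
    simp only [mEval, List.map_cons, List.map_nil, List.prod_cons, List.prod_nil,
      Bool.false_eq_true, if_false, mul_one] at hg
    calc g = a * (a₀ * (g⁻¹ * a))⁻¹ * a₀ := by group
      _ = a * a₀ := by rw [hg, inv_one, mul_one]
  | [(true, a), (true, c)], _ =>
    refine ⟨fun g => g * a * g = a₀⁻¹ * c⁻¹, fun g hg => ?_,
      hp.not_eventually_mul_mul_eq fun h => h1 ?_⟩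
    · simp only [mEval, List.map_cons, List.map_nil, List.prod_cons, List.prod_nil, if_true,
        mul_one] at hg
      calc g * a * g = a₀⁻¹ * (a₀ * (g * a * (g * c))) * c⁻¹ := by group
        _ = a₀⁻¹ * c⁻¹ := by rw [hg, mul_one]
    · simp [mEval, h]
  | [(false, a), (false, c)], _ =>
    refine ⟨fun g => g * a⁻¹ * g = c * a₀, fun g hg => ?_,
      hp.not_eventually_mul_mul_eq fun h => h1 ?_⟩
    · simp only [mEval, List.map_cons, List.map_nil, List.prod_cons, List.prod_nil,
        Bool.false_eq_true, if_false, mul_one] at hg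
      calc g * a⁻¹ * g = c * (a₀ * (g⁻¹ * a * (g⁻¹ * c)))⁻¹ * a₀ := by group
        _ = c * a₀ := by rw [hg, inv_one, mul_one]
    · simp [mEval, inv_eq_iff_eq_inv.1 h]
  | [(true, a), (false, c)], _ =>
    refine ⟨fun g => g * a * g⁻¹ = a₀⁻¹ * c⁻¹, fun g hg => ?_,
      hp.not_eventually_conj_eq fun h => h1 ?_⟩
    · simp only [mEval, List.map_cons, List.map_nil, List.prod_cons, List.prod_nil, if_true,
        Bool.false_eq_true, if_false, mul_one] at hg
      calc g * a * g⁻¹ = a₀⁻¹ * (a₀ * (g * a * (g⁻¹ * c))) * c⁻¹ := by group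
        _ = a₀⁻¹ * c⁻¹ := by rw [hg, mul_one]
    · simp [mEval, h]
  | [(false, a), (true, c)], _ =>
    refine ⟨fun g => g * (a₀⁻¹ * c⁻¹) * g⁻¹ = a, fun g hg => ?_,
      hp.not_eventually_conj_eq fun h => h1 ?_⟩
    · simp only [mEval, List.map_cons, List.map_nil, List.prod_cons, List.prod_nil, if_true,
        Bool.false_eq_true, if_false, mul_one] at hg
      calc g * (a₀⁻¹ * c⁻¹) * g⁻¹
          = g * (a₀⁻¹ * (a₀ * (g⁻¹ * a * (g * c))) * c⁻¹) * g⁻¹ := by rw [hg, mul_one]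
        _ = a := by group
    · simp [mEval, ← h]

lemma nhds_nthZariski (n : ℕ) (x : G) :
    @nhds G (nthZariski G n) x =
      generate {s | x ∈ s ∧ ∃ a₀ l, l.length ≤ n ∧ s = cozeroSet a₀ l} := by
  rw [nthZariski, TopologicalSpace.nhds_generateFrom, generate_eq_biInf]
  rfl

lemma singleton_one_notMem_nhds [Infinite G] : {1} ∉ @nhds G (nthZariski G 2) 1 := by
  rw [nhds_nthZariski, mem_generate_iff]
  rintro ⟨t, ht, htfin, hsub⟩
  obtain ⟨p, hp⟩ := exists_isGeneric G
  obtain ⟨Z, hZ, hev⟩ := exists_eventually_inv_mul_mem p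
    ((htfin.image compl).insert {1}) fun g => by
      by_cases hg : g ∈ ⋂₀ t
      · exact ⟨{1}, Set.mem_insert _ _, hsub hg⟩
      · simp only [Set.mem_sInter, not_forall] at hg
        obtain ⟨s, hs, hgs⟩ := hg
        exact ⟨sᶜ, Set.mem_insert_of_mem _ ⟨s, hs, rfl⟩, hgs⟩
  rcases hZ with rfl | ⟨s, hs, rfl⟩
  · exact hp.not_eventually_eq 1 hev
  · obtain ⟨h1, a₀, l, hl, rfl⟩ := ht hs
    exact hp.not_eventually_notMem_cozeroSet hl h1 hev

lemma sInter_nhds_nthZariski {n : ℕ} (hn : 1 ≤ n) (x : G) :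
    ⋂₀ {s | s ∈ @nhds G (nthZariski G n) x} = {x} := by
  refine Set.Subset.antisymm (fun g hg => ?_) ?_
  · by_contra hne
    have hmem : cozeroSet g⁻¹ [(true, 1)] ∈ @nhds G (nthZariski G n) x := by
      rw [nhds_nthZariski]
      refine mem_generate_of_mem ⟨?_, _, _, by simpa using hn, rfl⟩
      simpa [cozeroSet, mEval, inv_mul_eq_one] using hne
    simpa [cozeroSet, mEval] using hg _ hmem
  · rintro _ rfl s hs
    exact @mem_of_mem_nhds _ (nthZariski G n) _ _ hs

end Group

end SecondZariski

/-- For an infinite group `G`, no finite family of neighborhoods of `1` in the 2-nd Zariski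
topology has intersection `{1}`; that is, the pseudocharacter of `(G, 𝔷_{G²[x]})` at `1`
is at least `ℵ₀`. -/
theorem pseudoChar_secondZariski_ge_aleph0 {G : Type*} [Group G] [Infinite G] :
    (∀ 𝒰 : Set (Set G), 𝒰.Finite → (∀ s ∈ 𝒰, s ∈ @nhds G (nthZariski G 2) 1) →
      ⋂₀ 𝒰 ≠ {1}) ∧
    Cardinal.aleph0 ≤ pseudoChar (nthZariski G 2) (1 : G) := by
  have key : ∀ 𝒰 : Set (Set G), 𝒰.Finite → (∀ s ∈ 𝒰, s ∈ @nhds G (nthZariski G 2) 1) →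
      ⋂₀ 𝒰 ≠ {1} := fun 𝒰 hfin h heq =>
    SecondZariski.singleton_one_notMem_nhds (heq ▸ (Filter.sInter_mem hfin).2 h)
  refine ⟨key, ?_⟩
  have : Nonempty {𝒰 : Set (Set G) //
      (∀ s ∈ 𝒰, s ∈ @nhds G (nthZariski G 2) 1) ∧ ⋂₀ 𝒰 = {1}} :=
    ⟨⟨_, fun _ hs => hs, SecondZariski.sInter_nhds_nthZariski one_le_two 1⟩⟩
  refine le_ciInf fun ⟨𝒰, hnhds, hinter⟩ => ?_
  by_contra! hlt
  exact key 𝒰 (Cardinal.lt_aleph0_iff_set_finite.1 hlt) hnhds hinter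
end

section
/- There exists a group G of cardinality 2^{ℵ₀} containing two disjoint countable subsets A, B ⊆ G such that ⋂_{a∈A, b∈B} {x ∈ G : x a x⁻¹ b⁻¹ ≠ 1} = {1}; that is, for every x ∈ G with x ≠ 1 there exist a ∈ A and b ∈ B with x a x⁻¹ = b, while for every a ∈ A and b ∈ B one has a ≠ b. (Consequently the 2-nd Zariski topology of G has countable pseudocharacter at 1.) -/
/-- A pair of elements of `S₃`, none of them trivial, which no nontrivial conjugation preserves. -/
theorem exists_conj_notMem_pair (x : Equiv.Perm (Fin 3)) (hx : x ≠ 1) :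
    ∃ a ∈ ({Equiv.swap 0 1, finRotate 3} : Finset (Equiv.Perm (Fin 3))),
      x * a * x⁻¹ ∉ ({Equiv.swap 0 1, finRotate 3} : Finset (Equiv.Perm (Fin 3))) := by
  revert x
  decide

theorem one_notMem_pair :
    (1 : Equiv.Perm (Fin 3)) ∉
      ({Equiv.swap 0 1, finRotate 3} : Finset (Equiv.Perm (Fin 3))) := by
  decide

/-- If every nontrivial conjugation of `H` moves some element of `S` out of `S`, then in `ℕ → H`
the elements supported at one coordinate, split according to `S`, have the same property. -/
theorem exists_countable_disjoint_conj_pi {H : Type*} [Group H] [Countable H] (S : Set H)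
    (h1 : (1 : H) ∉ S) (hS : ∀ x : H, x ≠ 1 → ∃ a ∈ S, x * a * x⁻¹ ∉ S) :
    ∃ A B : Set (ℕ → H), A.Countable ∧ B.Countable ∧ Disjoint A B ∧
      ∀ x : ℕ → H, x ≠ 1 → ∃ a ∈ A, ∃ b ∈ B, x * a * x⁻¹ = b := by
  let f : ℕ × H → ℕ → H := fun p => Pi.mulSingle p.1 p.2
  refine ⟨f '' {p | p.2 ∈ S}, f '' {p | p.2 ∉ S}, (Set.to_countable _).image f,
    (Set.to_countable _).image f, ?_, fun x hx => ?_⟩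
  · rw [Set.disjoint_left]
    rintro _ ⟨⟨n, a⟩, ha, rfl⟩ ⟨⟨m, b⟩, hb, hab⟩
    have key := congrFun hab n
    simp only [f, Pi.mulSingle_eq_same] at key
    rcases eq_or_ne n m with rfl | hnm
    · rw [Pi.mulSingle_eq_same] at key
      exact hb (key ▸ ha)
    · rw [Pi.mulSingle_eq_of_ne hnm] at key
      exact h1 (key ▸ ha)
  · obtain ⟨n, hn⟩ := Function.ne_iff.mp hx
    obtain ⟨a, ha, hb⟩ := hS (x n) hn
    refine ⟨f (n, a), ⟨_, ha, rfl⟩, f (n, x n * a * (x n)⁻¹), ⟨_, hb, rfl⟩, ?_⟩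
    funext m
    rcases eq_or_ne m n with rfl | hmn
    · simp [f]
    · simp [f, Pi.mulSingle_eq_of_ne hmn]


/-- There is a group `G` of cardinality continuum containing disjoint countable subsets
`A, B` such that every `x ≠ 1` satisfies `x * a * x⁻¹ = b` for some `a ∈ A`, `b ∈ B`;
i.e. the co-zero sets of the monomials `x a x⁻¹ b⁻¹` (`a ∈ A`, `b ∈ B`) intersect in `{1}`. -/
theorem exists_group_continuum_countable_pseudochar :
    ∃ (G : Type) (inst : Group G),
      haveI := inst
      Cardinal.mk G = 2 ^ Cardinal.aleph0 ∧
      ∃ A B : Set G, A.Countable ∧ B.Countable ∧ Disjoint A B ∧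
        ∀ x : G, x ≠ 1 → ∃ a ∈ A, ∃ b ∈ B, x * a * x⁻¹ = b := by
  refine ⟨ℕ → Equiv.Perm (Fin 3), inferInstance, ?_, ?_⟩
  · rw [← Cardinal.power_def, Cardinal.mk_nat]
    refine Cardinal.power_eq_two_power le_rfl ?_ ?_
    · rw [Cardinal.mk_fintype, Fintype.card_perm]
      norm_cast
    · exact Cardinal.mk_le_aleph0
  · exact exists_countable_disjoint_conj_pi
      (({Equiv.swap 0 1, finRotate 3} : Finset (Equiv.Perm (Fin 3))) : Set (Equiv.Perm (Fin 3)))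
      one_notMem_pair exists_conj_notMem_pair
end

section
/- Let F be the free group on the set T of all finite binary sequences (i.e., on List Bool). For a ∈ T let a⌢0 and a⌢1 denote the sequences obtained by appending 0, respectively 1, to a. Then for all a, b ∈ T and every w ∈ F, w·((of a)·(of (a⌢0)))·w⁻¹ ≠ (of b)·(of (b⌢1)); that is, no element of the form a·(a⌢0) (a product of two distinct free generators) is conjugate in F to an element of the form b·(b⌢1). -/
/-- Conjugate products of two generators have the same weight under every integer weighting
of the generators. -/
theorem weight_eq_of_conj_of_mul_of {α : Type*} {x x' y y' : α} {w : FreeGroup α}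
    (h : w * (FreeGroup.of x * FreeGroup.of x') * w⁻¹ = FreeGroup.of y * FreeGroup.of y')
    (f : α → ℤ) : f x + f x' = f y + f y' := by
  have key := congrArg (FreeGroup.lift fun t => Multiplicative.ofAdd (f t)) h
  simp only [map_mul, map_inv, FreeGroup.lift_apply_of, mul_inv_cancel_comm, ← ofAdd_add] at key
  exact Multiplicative.ofAdd.injective key

/-- In the free group on the set of finite binary sequences, no element of the form
`a·(a⌢0)` (product of the generators `a` and `a ++ [false]`) is conjugate to an element
of the form `b·(b⌢1)`. -/
theorem left_not_conjugate_right (a b : List Bool) (w : FreeGroup (List Bool)) :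
    w * (FreeGroup.of a * FreeGroup.of (a ++ [false])) * w⁻¹ ≠
      FreeGroup.of b * FreeGroup.of (b ++ [true]) := by
  intro h
  have weight := weight_eq_of_conj_of_mul_of h
  have ha : a = b ++ [true] := by
    by_contra hne
    simpa [hne] using weight fun t => if t = b ++ [true] then 1 else 0
  have hb : b = a ++ [false] := by
    by_contra hne
    simpa [hne] using weight fun t => if t = a ++ [false] then 1 else 0
  have hlen_a := congrArg List.length ha
  have hlen_b := congrArg List.length hb
  simp only [List.length_append, List.length_singleton] at hlen_a hlen_b
  omega
end

section
/- Let G = FreeGroup(A) be the free group on a nonempty set A. For every family W of monomials over G of cardinality |W| < |G| such that w(1) ≠ 1 for every w ∈ W, there exists a subgroup H ≤ G of cardinality |H| = |G| such that w(h) ≠ 1 for every w ∈ W and every h ∈ H. Consequently the pseudocharacter of G in the Zariski topology 𝔷_{G[x]} equals |G|. -/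
open Topology

/-- A free group acts along a word: if each letter of `L` moves `p (i + 1)` to `p i`, then the
element represented by `L` moves `p L.length` to `p 0`. -/
theorem FreeGroup.lift_mk_apply_path {α β : Type*} (σ : α → Equiv.Perm β) (L : List (α × Bool))
    (p : ℕ → β)
    (h : ∀ i (hi : i < L.length),
      (cond L[i].2 (σ L[i].1) (σ L[i].1)⁻¹) (p (i + 1)) = p i) :
    FreeGroup.lift σ (FreeGroup.mk L) (p L.length) = p 0 := by
  induction L generalizing p with
  | nil => simp
  | cons x L ih =>
    have h0 := h 0 (by simp)
    have hs := ih (fun i => p (i + 1)) fun i hi => h (i + 1) (Nat.succ_lt_succ hi)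
    simp only [FreeGroup.lift_mk, List.map_cons, List.prod_cons, Equiv.Perm.mul_apply,
      List.length_cons] at hs ⊢
    rw [hs]
    simpa using h0

/-- In a reduced word, two adjacent letters over the same generator have the same exponent. -/
theorem FreeGroup.IsReduced.getElem_succ {α : Type*} {L : List (α × Bool)}
    (hL : FreeGroup.IsReduced L) {i : ℕ} (hi : i + 1 < L.length) (h : L[i].1 = L[i + 1].1) :
    L[i].2 = L[i + 1].2 :=
  List.isChain_iff_getElem.1 hL i hi h

/-- Free groups are residually finite. -/
instance FreeGroup.residuallyFinite (α : Type*) : Group.ResiduallyFinite (FreeGroup α) := by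
  classical
  refine Group.residuallyFinite_iff_exists_finiteIndex.2 fun g hg => ?_
  let L := g.toWord
  have hred : FreeGroup.IsReduced L := FreeGroup.isReduced_toWord
  let p : ℕ → Fin (L.length + 1) := fun i => Fin.ofNat _ i
  have hp : ∀ i j, i ≤ L.length → j ≤ L.length → p i = p j → i = j := by
    intro i j hi hj hij
    simpa [p, Fin.ext_iff, Nat.mod_eq_of_lt (Nat.lt_succ_of_le hi),
      Nat.mod_eq_of_lt (Nat.lt_succ_of_le hj)] using hij
  have key : ∀ a, ∃ σ : Equiv.Perm (Fin (L.length + 1)),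
      ∀ i : {i : Fin L.length // L[i].1 = a},
        σ (p (cond L[i.1.1].2 (i.1 + 1) i.1)) = p (cond L[i.1.1].2 i.1 (i.1 + 1)) := by
    intro a
    have adj : ∀ i j : {i : Fin L.length // L[i].1 = a}, i.1.1 + 1 = j.1.1 →
        L[i.1.1].2 = L[j.1.1].2 := by
      rintro ⟨⟨i, hi⟩, hia⟩ ⟨⟨j, hj⟩, hja⟩ hij
      dsimp at hij hia hja ⊢
      subst hij
      exact hred.getElem_succ hj (hia.trans hja.symm)
    apply Equiv.Perm.exists_extending_pair
    all_goals
      intro i j hij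
      dsimp only at hij
      have hi := i.1.2
      have hj := j.1.2
      have h1 := adj i j
      have h2 := adj j i
      have := hp _ _ (by cases L[i.1.1].2 <;> simp)
        (by cases L[j.1.1].2 <;> simp) hij
      apply Subtype.ext
      apply Fin.ext
      cases hbi : L[i.1.1].2 <;> cases hbj : L[j.1.1].2 <;> simp [hbi, hbj] at this h1 h2 <;> omega
  choose σ hσ using key
  refine ⟨(FreeGroup.lift σ).ker, inferInstance, fun hker => ?_⟩
  have hpath := FreeGroup.lift_mk_apply_path σ L p fun i hi => by
    have := hσ L[i].1 ⟨⟨i, hi⟩, rfl⟩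
    cases hb : L[i].2 <;> simp [hb] at this ⊢
    · rw [← this, Equiv.symm_apply_apply]
    · exact this
  rw [show FreeGroup.mk L = g from FreeGroup.mk_toWord, MonoidHom.mem_ker.1 hker] at hpath
  have := hp _ _ le_rfl (Nat.zero_le _) hpath
  exact hg (FreeGroup.toWord_eq_nil_iff.1 (List.length_eq_zero_iff.1 this))

/-- In an infinite residually finite group, finitely many nontrivial elements avoid some
infinite normal subgroup. -/
theorem Group.ResiduallyFinite.exists_infinite_normal_disjoint {G : Type*} [Group G] [Infinite G]
    [Group.ResiduallyFinite G] {S : Set G} (hS : S.Finite) (h1 : 1 ∉ S) :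
    ∃ N : Subgroup G, N.Normal ∧ Infinite N ∧ ∀ s ∈ S, s ∉ N := by
  have : Finite S := hS
  choose K hK using fun s : S =>
    Group.exists_finiteIndexNormalSubgroup_notMem s.1 (fun h => h1 (h ▸ s.2))
  have hfin : (⨅ s, (K s).toSubgroup).FiniteIndex :=
    Subgroup.finiteIndex_iInf fun s => (K s).isFiniteIndex'
  refine ⟨⨅ s, (K s).toSubgroup, Subgroup.normal_iInf_normal fun s => (K s).isNormal', ?_,
    fun s hs hmem => hK ⟨s, hs⟩ (Subgroup.mem_iInf.1 hmem ⟨s, hs⟩)⟩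
  rw [← not_finite_iff_infinite]
  exact fun h => not_finite_iff_infinite.2 ‹_›
    ((Subgroup.finite_iff_finite_and_finiteIndex _).2 ⟨h, hfin⟩)

open Cardinal in
/-- In a free group on uncountably many generators, fewer than `#α` nontrivial elements avoid
some normal subgroup of full cardinality. -/
theorem FreeGroup.exists_normal_disjoint_of_uncountable {α : Type*} (hα : ℵ₀ < #α)
    {S : Set (FreeGroup α)} (hS : #S < #α) (h1 : 1 ∉ S) :
    ∃ N : Subgroup (FreeGroup α), N.Normal ∧ #α ≤ #N ∧ ∀ s ∈ S, s ∉ N := by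
  classical
  have : Infinite α := infinite_iff.2 hα.le
  let B : Set α := ⋃ s : S, {a | a ∈ s.1.toWord.map Prod.fst}
  have hB : #B < #α := by
    refine (mk_iUnion_le _).trans_lt (mul_lt_of_lt hα.le hS (lt_of_le_of_lt ?_ hα))
    exact ciSup_le' fun s => (List.finite_toSet _).lt_aleph0.le
  let f : FreeGroup α →* FreeGroup α := FreeGroup.lift fun a => if a ∈ B then .of a else 1
  have hf : ∀ s ∈ S, f s = s := by
    intro s hs
    conv_rhs => rw [← MonoidHom.id_apply (FreeGroup α) s]
    rw [← FreeGroup.mk_toWord (x := s), ← FreeGroup.lift_of_eq_id, FreeGroup.lift_mk,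
      FreeGroup.lift_mk]
    congr 1
    refine List.map_congr_left fun x hx => ?_
    have : x.1 ∈ B := Set.mem_iUnion.2 ⟨⟨s, hs⟩, List.mem_map_of_mem hx⟩
    simp [this]
  refine ⟨f.ker, inferInstance, ?_, fun s hs hker => h1 ?_⟩
  · rw [← mk_compl_of_infinite B hB]
    exact mk_le_of_injective (f := fun a : (Bᶜ : Set α) => (⟨.of a.1, by
      simp [f, MonoidHom.mem_ker, show a.1 ∉ B from a.2]⟩ : f.ker))
      fun a b h => Subtype.ext (FreeGroup.of_injective (congrArg Subtype.val h))
  · rwa [← (hf s hs).symm.trans hker]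

open Cardinal in
/-- In a free group `G` on a nonempty set, fewer than `#G` nontrivial elements avoid
some normal subgroup of cardinality `#G`. -/
theorem FreeGroup.exists_normal_disjoint {α : Type*} [Nonempty α]
    {S : Set (FreeGroup α)} (hS : #S < #(FreeGroup α)) (h1 : 1 ∉ S) :
    ∃ N : Subgroup (FreeGroup α), N.Normal ∧ #N = #(FreeGroup α) ∧ ∀ s ∈ S, s ∉ N := by
  rcases le_or_gt #α ℵ₀ with hα | hα
  · rw [mk_freeGroup, max_eq_right hα] at *
    obtain ⟨N, hN, hinf, hdisj⟩ :=
      Group.ResiduallyFinite.exists_infinite_normal_disjoint (lt_aleph0_iff_set_finite.1 hS) h1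
    refine ⟨N, hN, le_antisymm ((mk_set_le _).trans ?_) (aleph0_le_mk N), hdisj⟩
    rw [mk_freeGroup, max_eq_right hα]
  · have hcard : #(FreeGroup α) = #α := by rw [mk_freeGroup, max_eq_left hα.le]
    obtain ⟨N, hN, hle, hdisj⟩ :=
      FreeGroup.exists_normal_disjoint_of_uncountable hα (hcard ▸ hS) h1
    exact ⟨N, hN, le_antisymm (mk_set_le _) (hcard ▸ hle), hdisj⟩

/-- A homomorphism that kills `g` does not distinguish the values of a monomial at `g` and `1`. -/
theorem map_mEval_of_map_eq_one {G K : Type*} [Group G] [Group K] (f : G →* K) {g : G}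
    (hg : f g = 1) (a₀ : G) (l : List (Bool × G)) : f (mEval a₀ l g) = f (mEval a₀ l 1) := by
  simp only [mEval, map_mul, map_list_prod, List.map_map]
  congr 3
  funext ⟨b, c⟩
  cases b <;> simp [hg]

/-- If a monomial does not take `1` into a normal subgroup `N`, it does not vanish on `N`. -/
theorem mEval_ne_one_of_mem {G : Type*} [Group G] {N : Subgroup G} [N.Normal] {a₀ : G}
    {l : List (Bool × G)} (hN : mEval a₀ l 1 ∉ N) {h : G} (hh : h ∈ N) : mEval a₀ l h ≠ 1 := by
  intro he
  have := map_mEval_of_map_eq_one (QuotientGroup.mk' N) ((QuotientGroup.eq_one_iff h).2 hh) a₀ l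
  rw [he, map_one] at this
  exact hN ((QuotientGroup.eq_one_iff _).1 this.symm)

open Cardinal in
/-- Fewer than `#G` monomials over a free group `G` that do not vanish at `1` have a common
subgroup of cardinality `#G` on which none of them vanishes. -/
theorem FreeGroup.exists_subgroup_mEval_ne_one {α : Type*} [Nonempty α]
    (W : Set (FreeGroup α × List (Bool × FreeGroup α)))
    (hW : #W < #(FreeGroup α)) (h1 : ∀ w ∈ W, mEval w.1 w.2 1 ≠ 1) :
    ∃ H : Subgroup (FreeGroup α), #H = #(FreeGroup α) ∧
      ∀ w ∈ W, ∀ h ∈ H, mEval w.1 w.2 h ≠ 1 := by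
  obtain ⟨N, hN, hcard, hdisj⟩ := FreeGroup.exists_normal_disjoint
    (S := (fun w => mEval w.1 w.2 1) '' W) (mk_image_le.trans_lt hW)
    (by rintro ⟨w, hw, h⟩; exact h1 w hw h)
  exact ⟨N, hcard, fun w hw h hh => mEval_ne_one_of_mem (hdisj _ ⟨w, hw, rfl⟩) hh⟩

/-- Neighbourhoods in the Zariski topology contain finite intersections of co-zero sets. -/
theorem exists_finite_monomials_of_mem_nhds {G : Type*} [Group G] {x : G} {s : Set G}
    (hs : s ∈ @nhds G (fullZariski G) x) :
    ∃ F : Set (G × List (Bool × G)), F.Finite ∧ (∀ w ∈ F, mEval w.1 w.2 x ≠ 1) ∧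
      ∀ g, (∀ w ∈ F, mEval w.1 w.2 g ≠ 1) → g ∈ s := by
  let _ := fullZariski G
  obtain ⟨_, ⟨T, ⟨hT, hTsub⟩, rfl⟩, hxT, hTs⟩ :=
    (TopologicalSpace.isTopologicalBasis_of_subbasis (t := fullZariski G) rfl).mem_nhds_iff.1 hs
  choose! a l hal using fun t (ht : t ∈ T) => hTsub ht
  refine ⟨(fun t => (a t, l t)) '' T, hT.image _, ?_, fun g hg => hTs fun t ht => ?_⟩
  · rintro _ ⟨t, ht, rfl⟩
    have := hxT t ht
    rwa [hal t ht] at this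
  · rw [hal t ht]
    exact hg _ ⟨t, ht, rfl⟩

/-- The complement of a point is open in the Zariski topology. -/
theorem compl_singleton_mem_nhds_fullZariski {G : Type*} [Group G] {x g : G} (h : g ≠ x) :
    {g}ᶜ ∈ @nhds G (fullZariski G) x := by
  have hopen : IsOpen[fullZariski G] ({g}ᶜ : Set G) := by
    refine .basic _ ⟨g⁻¹, [(true, 1)], ?_⟩
    ext y
    change y ≠ g ↔ mEval _ _ y ≠ 1
    rw [ne_comm]
    simp [mEval, inv_mul_eq_one]
  exact @IsOpen.mem_nhds G (fullZariski G) x _ hopen h.symm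

/-- The complements of the points other than `x` are Zariski neighbourhoods of `x` with
intersection `{x}`. -/
theorem compl_singletons_pseudobase {G : Type*} [Group G] (x : G) :
    (∀ s ∈ (fun g : G => ({g}ᶜ : Set G)) '' {x}ᶜ, s ∈ @nhds G (fullZariski G) x) ∧
      ⋂₀ ((fun g : G => ({g}ᶜ : Set G)) '' {x}ᶜ) = {x} := by
  refine ⟨?_, ?_⟩
  · rintro _ ⟨g, hg, rfl⟩
    exact compl_singleton_mem_nhds_fullZariski hg
  · ext y
    simp only [Set.sInter_image, Set.mem_iInter, Set.mem_compl_iff, Set.mem_singleton_iff]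
    exact ⟨fun h => by_contra fun hy => h y hy rfl, fun h g hg hyg => hg (hyg ▸ h)⟩

theorem pseudoChar_fullZariski_le {G : Type*} [Group G] (x : G) :
    pseudoChar (fullZariski G) x ≤ Cardinal.mk G :=
  (ciInf_le' _ ⟨_, compl_singletons_pseudobase x⟩).trans
    (Cardinal.mk_image_le.trans (Cardinal.mk_set_le _))

open Cardinal in
theorem FreeGroup.mk_le_pseudoChar_fullZariski {α : Type*} [Nonempty α] :
    #(FreeGroup α) ≤ pseudoChar (fullZariski (FreeGroup α)) 1 := by
  have : Nonempty {𝒰 : Set (Set (FreeGroup α)) //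
      (∀ s ∈ 𝒰, s ∈ @nhds _ (fullZariski (FreeGroup α)) 1) ∧ ⋂₀ 𝒰 = {1}} :=
    ⟨_, compl_singletons_pseudobase 1⟩
  refine le_ciInf ?_
  rintro ⟨𝒰, hnhds, hinter⟩
  by_contra! hlt
  choose F hfin hF1 hFs using fun s : 𝒰 => exists_finite_monomials_of_mem_nhds (hnhds s.1 s.2)
  have hcard : #(⋃ s, F s) < #(FreeGroup α) := by
    rcases finite_or_infinite 𝒰 with h𝒰 | h𝒰
    · exact (Set.finite_iUnion hfin).lt_aleph0.trans_le (aleph0_le_mk _)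
    · refine lt_of_le_of_lt ?_ hlt
      refine (mk_iUnion_le_sum_mk.trans (sum_le_mk_mul_iSup _)).trans ?_
      refine mul_le_of_le (aleph0_le_mk _) le_rfl (le_trans ?_ (aleph0_le_mk _))
      exact ciSup_le' fun s => (hfin s).lt_aleph0.le
  obtain ⟨H, hH, hne⟩ := FreeGroup.exists_subgroup_mEval_ne_one (⋃ s, F s) hcard (by
    intro w hw
    obtain ⟨s, hs⟩ := Set.mem_iUnion.1 hw
    exact hF1 s w hs)
  have hsub : (H : Set (FreeGroup α)) ⊆ {1} := by
    rw [← hinter]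
    exact fun h hh s hs =>
      hFs ⟨s, hs⟩ h fun w hw => hne w (Set.mem_iUnion.2 ⟨⟨s, hs⟩, hw⟩) h hh
  have hfinite : #H < ℵ₀ := ((Set.finite_singleton _).subset hsub).lt_aleph0
  exact (hH ▸ hfinite).not_ge (aleph0_le_mk _)

/-- For the free group `G = FreeGroup A` on a nonempty set `A` and any family `W` of
monomials over `G` (encoded as pairs `(a₀, l)`) with `|W| < |G|` and `w(1) ≠ 1` for all
`w ∈ W`, there is a subgroup `H ≤ G` with `|H| = |G|` on which no `w ∈ W` vanishes.
Consequently the pseudocharacter of `G` in the Zariski topology equals `|G|`. -/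
theorem pseudoChar_zariski_freeGroup {A : Type*} [Nonempty A]
    (W : Set (FreeGroup A × List (Bool × FreeGroup A)))
    (hW : Cardinal.mk W < Cardinal.mk (FreeGroup A))
    (h1 : ∀ w ∈ W, mEval w.1 w.2 1 ≠ 1) :
    (∃ H : Subgroup (FreeGroup A), Cardinal.mk H = Cardinal.mk (FreeGroup A) ∧
      ∀ w ∈ W, ∀ h ∈ H, mEval w.1 w.2 h ≠ 1) ∧
    pseudoChar (fullZariski (FreeGroup A)) (1 : FreeGroup A) =
      Cardinal.mk (FreeGroup A) := by
  exact ⟨FreeGroup.exists_subgroup_mEval_ne_one W hW h1,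
    le_antisymm (pseudoChar_fullZariski_le 1) FreeGroup.mk_le_pseudoChar_fullZariski⟩
end

section
/- Let G be an infinite group, A ⊆ G a finite subset, and let τ be the topology on G generated by the sub-base consisting of all sets {x ∈ G : b x^{ε} c ≠ 1} (b,c ∈ G, ε ∈ {−1,1}) together with all sets {x ∈ G : b x a x⁻¹ c ≠ 1} and {x ∈ G : b x⁻¹ a x c ≠ 1} (a ∈ A, b,c ∈ G). Then every family 𝒰 of τ-neighborhoods of the identity 1 with ⋂𝒰 = {1} has cardinality |𝒰| ≥ |G|; that is, the pseudocharacter of (G, τ) at 1 equals |G|. -/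
open Topology

/-- The sub-base consisting of the co-zero sets of the monomials `b x^ε c` (`b,c ∈ G`,
`ε ∈ {−1,1}`), `b x a x⁻¹ c` and `b x⁻¹ a x c` (`a ∈ A`, `b,c ∈ G`). -/
def subbasisA {G : Type*} [Group G] (A : Set G) : Set (Set G) :=
  {s | ∃ (b c : G) (ε : Bool), s = {x : G | b * (if ε then x else x⁻¹) * c ≠ 1}} ∪
  {s | ∃ a ∈ A, ∃ b c : G, s = {x : G | b * x * a * x⁻¹ * c ≠ 1}} ∪
  {s | ∃ a ∈ A, ∃ b c : G, s = {x : G | b * x⁻¹ * a * x * c ≠ 1}}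

/-- The topology on `G` generated by the sub-base `subbasisA A`. -/
def tauA {G : Type*} [Group G] (A : Set G) : TopologicalSpace G :=
  .generateFrom (subbasisA A)

open Cardinal in
theorem exists_isRegular_of_lt {α β : Cardinal} (hβ : ℵ₀ ≤ β) (h : α < β) :
    ∃ c : Cardinal, c.IsRegular ∧ α < c ∧ c ≤ β := by
  rcases lt_or_ge α ℵ₀ with hα | hα
  · exact ⟨ℵ₀, isRegular_aleph0, hα, hβ⟩
  · exact ⟨Order.succ α, isRegular_succ hα, Order.lt_succ α, Order.succ_le_of_lt h⟩

/-- A subset of a group meeting only one coset of a subgroup is at most as large as the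
subgroup. -/
theorem mk_le_subgroup_of_inv_mul_mem {G : Type*} [Group G] (H : Subgroup G) (s : Set G)
    (h : ∀ x ∈ s, ∀ y ∈ s, x⁻¹ * y ∈ H) : Cardinal.mk s ≤ Cardinal.mk H := by
  rcases s.eq_empty_or_nonempty with rfl | ⟨x, hx⟩
  · simp
  · refine Cardinal.mk_le_of_injective (f := fun y : s => (⟨x⁻¹ * y, h x hx y y.2⟩ : H)) ?_
    intro y z hyz
    simpa [Subtype.ext_iff] using hyz

theorem mk_le_subgroup_of_mul_inv_mem {G : Type*} [Group G] (H : Subgroup G) (s : Set G)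
    (h : ∀ x ∈ s, ∀ y ∈ s, y * x⁻¹ ∈ H) : Cardinal.mk s ≤ Cardinal.mk H := by
  rcases s.eq_empty_or_nonempty with rfl | ⟨x, hx⟩
  · simp
  · refine Cardinal.mk_le_of_injective (f := fun y : s => (⟨y * x⁻¹, h x hx y y.2⟩ : H)) ?_
    intro y z hyz
    simpa [Subtype.ext_iff] using hyz

theorem mem_centralizer_insert {G : Type*} [Group G] {a x : G} {B : Set G}
    (ha : x * a = a * x) (hx : x ∈ Subgroup.centralizer B) :
    x ∈ Subgroup.centralizer (insert a B) := by
  rw [Subgroup.mem_centralizer_iff] at hx ⊢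
  rintro h (rfl | hh)
  · exact ha.symm
  · exact hx h hh

/-- The complement of a subbasic neighborhood of `1` meets the centralizer of `B` in at most one
point or in a part of a coset of the centralizer of `insert a B` for some `a ∈ A \ B`. -/
theorem mk_compl_inter_centralizer_le {G : Type*} [Group G] {A : Set G} {s : Set G}
    (hs : s ∈ subbasisA A) (h1 : 1 ∈ s) (B : Set G) :
    Cardinal.mk (sᶜ ∩ (Subgroup.centralizer B : Set G) : Set G) ≤ 1 ∨
    ∃ a ∈ A, a ∉ B ∧ Cardinal.mk (sᶜ ∩ (Subgroup.centralizer B : Set G) : Set G) ≤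
      Cardinal.mk (Subgroup.centralizer (insert a B)) := by
  rcases (sᶜ ∩ (Subgroup.centralizer B : Set G)).eq_empty_or_nonempty with he | ⟨z, hz, hzB⟩
  · left
    simp [he]
  rw [SetLike.mem_coe, Subgroup.mem_centralizer_iff] at hzB
  rcases hs with (⟨b, c, ε, rfl⟩ | ⟨a, haA, b, c, rfl⟩) | ⟨a, haA, b, c, rfl⟩
  · left
    rw [Cardinal.mk_le_one_iff_set_subsingleton]
    rintro x ⟨hx, -⟩ y ⟨hy, -⟩
    simp only [Set.mem_compl_iff, Set.mem_ofPred_eq, not_not] at hx hy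
    have hxy := hx.trans hy.symm
    cases ε <;> simpa using hxy
  · right
    refine ⟨a, haA, fun haB => ?_, mk_le_subgroup_of_inv_mul_mem _ _ ?_⟩
    · simp only [Set.mem_compl_iff, Set.mem_ofPred_eq, not_not] at hz h1
      apply h1
      refine Eq.trans ?_ hz
      rw [mul_assoc b z a, ← hzB a haB]
      group
    · rintro x ⟨hx, hxB⟩ y ⟨hy, hyB⟩
      simp only [Set.mem_compl_iff, Set.mem_ofPred_eq, not_not] at hx hy
      refine mem_centralizer_insert ?_ (mul_mem (inv_mem hxB) hyB)
      have hxy : x * a * x⁻¹ = y * a * y⁻¹ := by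
        simpa [mul_assoc] using mul_right_cancel (hx.trans hy.symm)
      calc x⁻¹ * y * a = x⁻¹ * (y * a * y⁻¹) * y := by group
        _ = a * (x⁻¹ * y) := by rw [← hxy]; group
  · right
    refine ⟨a, haA, fun haB => ?_, mk_le_subgroup_of_mul_inv_mem _ _ ?_⟩
    · simp only [Set.mem_compl_iff, Set.mem_ofPred_eq, not_not] at hz h1
      apply h1
      refine Eq.trans ?_ hz
      rw [mul_assoc (b * z⁻¹) a z, hzB a haB]
      group
    · rintro x ⟨hx, hxB⟩ y ⟨hy, hyB⟩
      simp only [Set.mem_compl_iff, Set.mem_ofPred_eq, not_not] at hx hy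
      refine mem_centralizer_insert ?_ (mul_mem hyB (inv_mem hxB))
      have hxy : x⁻¹ * a * x = y⁻¹ * a * y := by
        simpa [mul_assoc] using mul_right_cancel (hx.trans hy.symm)
      calc y * x⁻¹ * a = y * (x⁻¹ * a * x) * x⁻¹ := by group
        _ = a * (y * x⁻¹) := by rw [hxy]; group

/-- If fewer than `c` subbasic neighborhoods of `1` intersect in `{1}`, for a regular cardinal `c`,
then all centralizers of sets containing `A` up to finitely many elements are smaller than `c`. -/
theorem mk_centralizer_lt {G : Type*} [Group G] {A : Set G} {c : Cardinal} (hc : c.IsRegular)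
    {T : Set (Set G)} (hT : T ⊆ subbasisA A) (h1 : ∀ s ∈ T, 1 ∈ s) (hTc : Cardinal.mk T < c)
    (hT1 : ⋂₀ T ⊆ {1}) (D : Finset G) :
    ∀ B : Set G, A ⊆ B ∪ D → Cardinal.mk (Subgroup.centralizer B) < c := by
  classical
  induction D using Finset.strongInduction with
  | H D ih =>
    intro B hB
    have hone : (1 : Cardinal) < c := Cardinal.one_lt_aleph0.trans_le hc.aleph0_le
    have hpiece : ∀ s ∈ T,
        Cardinal.mk (sᶜ ∩ (Subgroup.centralizer B : Set G) : Set G) < c := by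
      intro s hs
      rcases mk_compl_inter_centralizer_le (hT hs) (h1 s hs) B with h | ⟨a, haA, haB, h⟩
      · exact h.trans_lt hone
      · have haD : a ∈ D := by simpa [haB] using hB haA
        refine h.trans_lt (ih (D.erase a) (Finset.erase_ssubset haD) _ fun x hx => ?_)
        rcases hB hx with hx | hx
        · exact Or.inl (Or.inr hx)
        · by_cases hxa : x = a
          · exact Or.inl (Or.inl hxa)
          · exact Or.inr (by simpa [hxa] using hx)
    have hcover : (Subgroup.centralizer B : Set G) ⊆
        {1} ∪ ⋃ s ∈ T, (sᶜ ∩ (Subgroup.centralizer B : Set G)) := by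
      intro x hx
      by_cases hx1 : x = 1
      · exact Or.inl hx1
      · obtain ⟨s, hs, hxs⟩ : ∃ s ∈ T, x ∉ s := by
          by_contra! h
          exact hx1 (hT1 h)
        exact Or.inr (Set.mem_biUnion hs ⟨hxs, hx⟩)
    refine (Cardinal.mk_le_mk_of_subset hcover).trans_lt ((Cardinal.mk_union_le _ _).trans_lt ?_)
    refine Cardinal.add_lt_of_lt hc.aleph0_le (by simpa using hone) ?_
    exact (Cardinal.card_biUnion_lt_iff_forall_of_isRegular hc hTc).2 hpiece

theorem exists_finite_sInter_subset_of_mem_nhds_generateFrom {X : Type*} {S : Set (Set X)} {x : X}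
    {U : Set X} (hU : U ∈ @nhds X (.generateFrom S) x) :
    ∃ F : Set (Set X), F.Finite ∧ F ⊆ S ∧ (∀ s ∈ F, x ∈ s) ∧ ⋂₀ F ⊆ U := by
  let : TopologicalSpace X := .generateFrom S
  obtain ⟨_, ⟨F, ⟨hF, hFS⟩, rfl⟩, hx, hFU⟩ :=
    (TopologicalSpace.isTopologicalBasis_of_subbasis (s := S) rfl).mem_nhds_iff.1 hU
  exact ⟨F, hF, hFS, hx, hFU⟩

theorem mk_le_of_sInter_nhds_tauA {G : Type*} [Group G] [Infinite G] {A : Set G} (hA : A.Finite)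
    {𝒰 : Set (Set G)} (h𝒰 : ∀ s ∈ 𝒰, s ∈ @nhds G (tauA A) 1) (h1 : ⋂₀ 𝒰 = {1}) :
    Cardinal.mk G ≤ Cardinal.mk 𝒰 := by
  by_contra! hlt
  obtain ⟨c, hc, h𝒰c, hcG⟩ := exists_isRegular_of_lt (Cardinal.aleph0_le_mk G) hlt
  choose! F hFfin hFS hF1 hFU using fun s hs =>
    exists_finite_sInter_subset_of_mem_nhds_generateFrom (h𝒰 s hs)
  have hTc : Cardinal.mk (⋃ s ∈ 𝒰, F s : Set (Set G)) < c :=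
    (Cardinal.card_biUnion_lt_iff_forall_of_isRegular hc h𝒰c).2 fun s hs =>
      (hFfin s hs).lt_aleph0.trans_le hc.aleph0_le
  have hT1 : ⋂₀ (⋃ s ∈ 𝒰, F s) ⊆ {1} := by
    rw [← h1]
    exact fun x hx s hs => hFU s hs fun t ht => hx t (Set.mem_biUnion hs ht)
  have hG := mk_centralizer_lt hc (Set.iUnion₂_subset hFS)
    (by simpa using fun t s hs ht => hF1 s hs t ht) hTc hT1 hA.toFinset ∅ (by simp)
  have hempty : Subgroup.centralizer (∅ : Set G) = ⊤ := by
    ext x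
    simp [Subgroup.mem_centralizer_iff]
  rw [hempty] at hG
  have htop : Cardinal.mk (⊤ : Subgroup G) = Cardinal.mk G :=
    Cardinal.mk_congr Subgroup.topEquiv.toEquiv
  exact (htop ▸ hG).not_ge hcG

theorem compl_singleton_mem_nhds_tauA {G : Type*} [Group G] (A : Set G) {x y : G} (h : x ≠ y) :
    {y}ᶜ ∈ @nhds G (tauA A) x := by
  let := tauA A
  refine IsOpen.mem_nhds (TopologicalSpace.isOpen_generateFrom_of_mem ?_) h
  refine Or.inl (Or.inl ⟨1, y⁻¹, true, ?_⟩)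
  ext z
  simp [mul_inv_eq_one]

/-- For an infinite group `G` and finite `A ⊆ G`, every family of `tauA A`-neighborhoods
of `1` with intersection `{1}` has cardinality at least `|G|`; that is, the pseudocharacter
of `(G, tauA A)` at `1` equals `|G|`. -/
theorem pseudoChar_tauA {G : Type*} [Group G] [Infinite G] (A : Set G) (hA : A.Finite) :
    (∀ 𝒰 : Set (Set G), (∀ s ∈ 𝒰, s ∈ @nhds G (tauA A) 1) → ⋂₀ 𝒰 = {1} →
      Cardinal.mk G ≤ Cardinal.mk 𝒰) ∧
    pseudoChar (tauA A) (1 : G) = Cardinal.mk G := by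
  refine ⟨fun 𝒰 h𝒰 h1 => mk_le_of_sInter_nhds_tauA hA h𝒰 h1, ?_⟩
  let 𝒱 : {𝒰 : Set (Set G) // (∀ s ∈ 𝒰, s ∈ @nhds G (tauA A) 1) ∧ ⋂₀ 𝒰 = {1}} :=
    ⟨(fun y : G => ({y}ᶜ : Set G)) '' {1}ᶜ, by
      rintro _ ⟨y, hy, rfl⟩
      exact compl_singleton_mem_nhds_tauA A (Ne.symm hy), by
      ext x
      simp only [Set.sInter_image, Set.mem_iInter, Set.mem_compl_iff, Set.mem_singleton_iff]
      exact ⟨fun h => by_contra fun hx => h x hx rfl, fun hx y hy hxy => hy (hxy ▸ hx)⟩⟩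
  have : Nonempty {𝒰 : Set (Set G) // (∀ s ∈ 𝒰, s ∈ @nhds G (tauA A) 1) ∧ ⋂₀ 𝒰 = {1}} := ⟨𝒱⟩
  apply le_antisymm
  · exact (ciInf_le' _ 𝒱).trans (Cardinal.mk_image_le.trans (Cardinal.mk_set_le _))
  · exact le_ciInf fun 𝒰 => mk_le_of_sInter_nhds_tauA hA 𝒰.2.1 𝒰.2.2
end

section
/- Let G be an infinite group, A ⊆ G a finite subset, and let (aᵢ, dᵢ)_{i∈I} be a family of pairs with aᵢ ∈ A, dᵢ ∈ G, aᵢ ≠ dᵢ for all i, and |I| < |G|. Then there exists a subset Y ⊆ G with |Y| = |G|, Y = Y⁻¹, such that for every i ∈ I and every y ∈ Y one has y aᵢ y⁻¹ ≠ dᵢ (and hence also y⁻¹ aᵢ y ≠ dᵢ). -/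
/-- Elements of a subgroup `K` conjugating `a` into a fixed position form at most one coset of
the centralizer of `a` in `K`. -/
theorem mk_conj_mem_le {G : Type*} [Group G] (K : Subgroup G) (a : G) (D : Set G) :
    Cardinal.mk {y : G | y ∈ K ∧ y * a * y⁻¹ ∈ D} ≤
      Cardinal.mk D * Cardinal.mk (K ⊓ Subgroup.centralizer {a} : Subgroup G) := by
  refine Cardinal.mk_le_mk_mul_of_mk_preimage_le
    (fun y : {y : G | y ∈ K ∧ y * a * y⁻¹ ∈ D} => (⟨y.1 * a * y.1⁻¹, y.2.2⟩ : D)) fun d => ?_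
  rcases isEmpty_or_nonempty ((fun y : {y : G | y ∈ K ∧ y * a * y⁻¹ ∈ D} =>
    (⟨y.1 * a * y.1⁻¹, y.2.2⟩ : D)) ⁻¹' {d}) with h | ⟨⟨⟨y₀, hy₀⟩, e₀⟩⟩
  · simp
  · have e₀' : y₀ * a * y₀⁻¹ = d := congrArg Subtype.val e₀
    refine Cardinal.mk_le_of_injective (f := fun z => ⟨y₀⁻¹ * z.1.1, ?_, ?_⟩) ?_
    · exact K.mul_mem (K.inv_mem hy₀.1) z.1.2.1
    · have e : z.1.1 * a * z.1.1⁻¹ = d := congrArg Subtype.val z.2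
      refine Subgroup.mem_centralizer_singleton_iff.2 ?_
      rw [← e₀'] at e
      have e' : z.1.1 * a = y₀ * a * y₀⁻¹ * z.1.1 := by rw [← e]; group
      rw [mul_assoc, e']
      group
    · intro z w h
      exact Subtype.ext (Subtype.ext (mul_left_cancel (congrArg Subtype.val h)))

theorem mk_finite_biUnion_lt {ι α : Type*} {s : Set ι} (hs : s.Finite) {f : ι → Set α}
    {c : Cardinal} (hc : Cardinal.aleph0 ≤ c) (hf : ∀ i ∈ s, Cardinal.mk (f i) < c) :
    Cardinal.mk (⋃ i ∈ s, f i : Set α) < c := by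
  induction s, hs using Set.Finite.induction_on with
  | empty => simpa using Cardinal.aleph0_pos.trans_le hc
  | @insert i s _ _ ih =>
    rw [Set.biUnion_insert]
    exact (Cardinal.mk_union_le _ _).trans_lt (Cardinal.add_lt_of_lt hc
      (hf i (Set.mem_insert i s)) (ih fun j hj => hf j (Set.mem_insert_of_mem i hj)))

/-- A finite set has a subset `T` whose centralizer `K` has full cardinality, but the centralizer
in `K` of any further element of the set is smaller. -/
theorem exists_centralizer_mk_eq {G : Type*} [Group G] {A : Set G} (hA : A.Finite) :
    ∃ T ⊆ A, Cardinal.mk (Subgroup.centralizer T) = Cardinal.mk G ∧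
      ∀ a ∈ A, a ∉ T → Cardinal.mk
        (Subgroup.centralizer T ⊓ Subgroup.centralizer {a} : Subgroup G) < Cardinal.mk G := by
  have hfin : {T : Set G | T ⊆ A ∧
      Cardinal.mk (Subgroup.centralizer T) = Cardinal.mk G}.Finite :=
    hA.finite_subsets.subset fun T hT => hT.1
  obtain ⟨T, ⟨hTA, hT⟩, hmax⟩ := hfin.exists_maximal ⟨∅, Set.empty_subset A, by
    rw [Subgroup.centralizer_eq_top_iff_subset.2 (Set.empty_subset _)]
    exact Cardinal.mk_univ⟩
  refine ⟨T, hTA, hT, fun a ha haT => (Cardinal.mk_set_le _).lt_of_ne fun h => haT ?_⟩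
  refine hmax ⟨Set.insert_subset ha hTA, ?_⟩ (Set.subset_insert a T) (Set.mem_insert a T)
  rw [← h]
  congr 2
  ext y
  simp [Subgroup.mem_centralizer_iff, and_comm]

/-- Let `G` be an infinite group, `A ⊆ G` finite, and `W` a family of pairs `(a, d)` with
`a ∈ A`, `a ≠ d`, of cardinality `< |G|`.  Then there is a symmetric subset `Y ⊆ G` of
cardinality `|G|` such that `y a y⁻¹ ≠ d` (and hence also `y⁻¹ a y ≠ d`) for all
`(a, d) ∈ W` and `y ∈ Y`. -/
theorem exists_symmetric_nonconjugating {G : Type*} [Group G] [Infinite G]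
    (A : Set G) (hA : A.Finite) (W : Set (G × G))
    (hWA : ∀ p ∈ W, p.1 ∈ A) (hWne : ∀ p ∈ W, p.1 ≠ p.2)
    (hW : Cardinal.mk W < Cardinal.mk G) :
    ∃ Y : Set G, Cardinal.mk Y = Cardinal.mk G ∧ Y⁻¹ = Y ∧
      (∀ p ∈ W, ∀ y ∈ Y, y * p.1 * y⁻¹ ≠ p.2) ∧
      (∀ p ∈ W, ∀ y ∈ Y, y⁻¹ * p.1 * y ≠ p.2) := by
  have hG := Cardinal.aleph0_le_mk G
  obtain ⟨T, -, hT, hlt⟩ := exists_centralizer_mk_eq hA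
  set K := Subgroup.centralizer T
  set B : Set G := ⋃ a ∈ A, {y | y ∈ K ∧ y * a * y⁻¹ ∈ {d | (a, d) ∈ W}}
  have hB : Cardinal.mk B < Cardinal.mk G := by
    refine mk_finite_biUnion_lt hA hG fun a ha => ?_
    by_cases haT : a ∈ T
    · have : {y | y ∈ K ∧ y * a * y⁻¹ ∈ {d | (a, d) ∈ W}} = ∅ := by
        refine Set.eq_empty_of_forall_notMem fun y hy => hWne _ hy.2 ?_
        exact eq_mul_inv_of_mul_eq (Subgroup.mem_centralizer_iff.1 hy.1 a haT)
      rw [this, Cardinal.mk_eq_zero]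
      exact Cardinal.aleph0_pos.trans_le hG
    · refine (mk_conj_mem_le K a _).trans_lt (Cardinal.mul_lt_of_lt hG ?_ (hlt a ha haT))
      refine (Cardinal.mk_le_of_injective (f := fun d => (⟨(a, d.1), d.2⟩ : W)) ?_).trans_lt hW
      intro d e h
      exact Subtype.ext (congrArg (fun p : W => p.1.2) h)
  have hBB : Cardinal.mk (B ∪ B⁻¹ : Set G) < Cardinal.mk G :=
    (Cardinal.mk_union_le _ _).trans_lt
      (Cardinal.add_lt_of_lt hG hB (by rwa [Cardinal.mk_inv]))
  have hnot : ∀ p ∈ W, ∀ y ∈ K, y ∉ B → y * p.1 * y⁻¹ ≠ p.2 := fun p hp y hy hyB h =>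
    hyB (Set.mem_biUnion (hWA p hp) ⟨hy, by rw [h]; exact hp⟩)
  refine ⟨(K : Set G) \ (B ∪ B⁻¹), ?_, ?_, ?_, ?_⟩
  · refine (Cardinal.mk_set_le _).eq_of_not_lt fun h => ?_
    refine (Cardinal.add_lt_of_lt hG h hBB).not_ge ?_
    calc Cardinal.mk G = Cardinal.mk (K : Set G) := hT.symm
      _ ≤ Cardinal.mk ((K : Set G) \ (B ∪ B⁻¹) ∪ (B ∪ B⁻¹) : Set G) :=
        Cardinal.mk_le_mk_of_subset (by rw [Set.sdiff_union_self]; exact Set.subset_union_left)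
      _ ≤ _ := Cardinal.mk_union_le _ _
  · ext y
    simp only [Set.mem_inv, Set.mem_sdiff, Set.mem_union, SetLike.mem_coe, inv_inv, inv_mem_iff,
      or_comm]
  · exact fun p hp y hy => hnot p hp y hy.1 fun h => hy.2 (Or.inl h)
  · intro p hp y hy
    simpa using hnot p hp y⁻¹ (K.inv_mem hy.1) fun h => hy.2 (Or.inr h)
end

section
/- For any disjoint finite subsets A and B of an infinite group G, the set {x ∈ G : x A x⁻¹ ∩ B = ∅} is infinite, where x A x⁻¹ = {x a x⁻¹ : a ∈ A}. -/
open scoped Pointwise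

/-- The elements `x` with `x * a * x⁻¹ = c * a * c⁻¹` form the left coset by `c` of the
centralizer of `a`. -/
theorem mem_smul_centralizer_iff {G : Type*} [Group G] {a c x : G} :
    x ∈ c • (Subgroup.centralizer {a} : Set G) ↔ x * a * x⁻¹ = c * a * c⁻¹ := by
  rw [Set.mem_smul_set_iff_inv_smul_mem, smul_eq_mul, SetLike.mem_coe,
    Subgroup.mem_centralizer_singleton_iff, mul_inv_eq_iff_eq_mul, mul_assoc, inv_mul_eq_iff_eq_mul]
  simp only [mul_assoc]

/-- For any disjoint finite subsets `A, B` of an infinite group `G`, the set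
`{x ∈ G : x A x⁻¹ ∩ B = ∅}` is infinite. -/
theorem infinite_nonconjugating {G : Type*} [Group G] [Infinite G]
    (A B : Set G) (hA : A.Finite) (hB : B.Finite) (hAB : Disjoint A B) :
    {x : G | (fun a => x * a * x⁻¹) '' A ∩ B = ∅}.Infinite := by
  classical
  intro hF
  let conj : G × G → Prop := fun p => ∃ x, x * p.1 * x⁻¹ = p.2
  let s : Finset ((G × G) ⊕ G) :=
    ((hA.toFinset ×ˢ hB.toFinset).filter conj).disjSum hF.toFinset
  let g : (G × G) ⊕ G → G := Sum.elim (fun p => if h : conj p then h.choose else 1) id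
  let H : (G × G) ⊕ G → Subgroup G := Sum.elim (fun p => Subgroup.centralizer {p.1}) fun _ => ⊥
  have hg (p : G × G) (hp : conj p) : g (.inl p) * p.1 * (g (.inl p))⁻¹ = p.2 := by
    simpa [g, hp] using hp.choose_spec
  have hcover : ⋃ i ∈ s, g i • (H i : Set G) = Set.univ := by
    refine Set.eq_univ_of_forall fun x => ?_
    rw [Set.mem_iUnion₂]
    by_cases hx : (fun a => x * a * x⁻¹) '' A ∩ B = ∅
    · exact ⟨.inr x, by simpa [s] using hx, by simp [g, H]⟩
    · obtain ⟨_, ⟨a, ha, rfl⟩, hb⟩ := Set.nonempty_iff_ne_empty.mpr hx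
      have hp : conj (a, x * a * x⁻¹) := ⟨x, rfl⟩
      refine ⟨.inl (a, x * a * x⁻¹), ?_, mem_smul_centralizer_iff.mpr (hg _ hp).symm⟩
      exact Finset.inl_mem_disjSum.mpr <| Finset.mem_filter.mpr
        ⟨Finset.mem_product.mpr ⟨hA.mem_toFinset.mpr ha, hB.mem_toFinset.mpr hb⟩, hp⟩
  have hone := (Subgroup.leftCoset_cover_filter_FiniteIndex hcover).symm ▸ Set.mem_univ (1 : G)
  obtain ⟨i, hi, h1⟩ := Set.mem_iUnion₂.mp hone
  obtain ⟨his, hfin⟩ := Finset.mem_filter.mp hi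
  rcases i with p | y
  · obtain ⟨hpAB, hp⟩ := Finset.mem_filter.mp (Finset.inl_mem_disjSum.mp his)
    obtain ⟨ha, hb⟩ := Finset.mem_product.mp hpAB
    have heq : p.1 = p.2 := by
      simpa using (mem_smul_centralizer_iff.mp h1).trans (hg p hp)
    exact Set.disjoint_left.mp hAB (hA.mem_toFinset.mp ha) (heq ▸ hB.mem_toFinset.mp hb)
  · exact hfin.index_ne_zero (by simp [H])
end

section
/- Let n ≥ 1 and let G be a group whose n-th Zariski topology 𝔷_{Gⁿ[x]} is non-discrete. Then for any finite subsets A₀, A₁, …, Aₙ of G with 1 ∉ A₀A₁⋯Aₙ there exists an infinite subset X ⊆ G with X = X⁻¹ and 1 ∈ X such that 1 ∉ A₀XA₁X⋯XAₙ, where A₀XA₁X⋯XAₙ denotes the set of all products a₀x₁a₁x₂a₂⋯xₙaₙ with aᵢ ∈ Aᵢ and x₁,…,xₙ ∈ X. -/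
open Topology

/-- `f` is the evaluation map of a monomial of degree at most `k`. -/
def IsMonomialMap {G : Type*} [Group G] (k : ℕ) (f : G → G) : Prop :=
  ∃ a₀ l, l.length ≤ k ∧ f = mEval a₀ l

namespace IsMonomialMap

variable {G : Type*} [Group G] {k m : ℕ} {f f' : G → G}

theorem mono (hf : IsMonomialMap k f) (hkm : k ≤ m) : IsMonomialMap m f := by
  obtain ⟨a, l, hl, rfl⟩ := hf
  exact ⟨a, l, hl.trans hkm, rfl⟩

theorem const (c : G) : IsMonomialMap k fun _ => c :=
  ⟨c, [], by simp, by ext; simp [mEval]⟩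

theorem id : IsMonomialMap 1 fun g : G => g :=
  ⟨1, [(true, 1)], by simp, by ext; simp [mEval]⟩

theorem inv : IsMonomialMap 1 fun g : G => g⁻¹ :=
  ⟨1, [(false, 1)], by simp, by ext; simp [mEval]⟩

theorem mul (hf : IsMonomialMap k f) (hf' : IsMonomialMap m f') :
    IsMonomialMap (k + m) fun g => f g * f' g := by
  obtain ⟨a, l, hl, rfl⟩ := hf
  refine mono ?_ (Nat.add_le_add_right hl m)
  clear hl
  induction l generalizing a with
  | nil =>
    obtain ⟨b, l', hl', rfl⟩ := hf'
    exact ⟨a * b, l', by simpa using hl', by ext; simp [mEval, mul_assoc]⟩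
  | cons p l ih =>
    obtain ⟨b, l', hl', h⟩ := ih p.2
    refine ⟨a, (p.1, b) :: l', by simp only [List.length_cons]; omega, ?_⟩
    ext g
    have hg := congrFun h g
    simp only [mEval] at hg
    simp only [mEval, List.map_cons, List.prod_cons, mul_assoc] at hg ⊢
    rw [hg]

theorem listProd {n : ℕ} {φ : Fin n → G → G} (hφ : ∀ j, IsMonomialMap 1 (φ j)) :
    IsMonomialMap n fun g => (List.ofFn fun j => φ j g).prod := by
  induction n with
  | zero => simpa using const 1
  | succ n ih =>
    simp only [List.ofFn_succ, List.prod_cons]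
    exact ((hφ 0).mul (ih fun j => hφ j.succ)).mono (Nat.add_comm 1 n).le

theorem comp_mul_left (hf : IsMonomialMap k f) (h : G) : IsMonomialMap k fun g => f (h * g) := by
  obtain ⟨a, l, hl, rfl⟩ := hf
  refine mono ?_ hl
  clear hl
  induction l generalizing a with
  | nil => simpa [mEval] using const a
  | cons p l ih =>
    have hp : IsMonomialMap 1 fun g => if p.1 then h * g else (h * g)⁻¹ := by
      cases p.1
      · simpa using (inv (G := G)).mul (const (k := 0) h⁻¹)
      · simpa using (const (k := 0) h).mul id
    convert ((const (k := 0) a).mul hp).mul (ih p.2) using 1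
    · simp only [List.length_cons]; omega
    · ext g
      simp [mEval, mul_assoc]

theorem isOpen_ne_one (hf : IsMonomialMap k f) : IsOpen[nthZariski G k] {g | f g ≠ 1} := by
  obtain ⟨a, l, hl, rfl⟩ := hf
  exact .basic _ ⟨a, l, hl, rfl⟩

end IsMonomialMap

section nthZariski

variable {G : Type*} [Group G] {n : ℕ}

theorem continuous_mul_left_nthZariski (h : G) :
    Continuous[nthZariski G n, nthZariski G n] (h * ·) := by
  refine continuous_generateFrom_iff.2 ?_
  rintro _ ⟨a, l, hl, rfl⟩
  exact (IsMonomialMap.comp_mul_left ⟨a, l, hl, rfl⟩ h).isOpen_ne_one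

theorem not_isOpen_singleton_one_nthZariski (hnd : nthZariski G n ≠ ⊥) :
    ¬ IsOpen[nthZariski G n] ({1} : Set G) := by
  let := nthZariski G n
  refine fun ho => hnd (eq_bot_of_singletons_open fun h => ?_)
  convert ho.preimage (continuous_mul_left_nthZariski h⁻¹) using 1
  ext g
  simp [eq_comm]

theorem isOpen_compl_singleton_nthZariski (hn : 1 ≤ n) (x : G) :
    IsOpen[nthZariski G n] {g : G | g ≠ x} := by
  convert ((IsMonomialMap.id.mul (.const (k := 0) x⁻¹)).mono hn).isOpen_ne_one using 1
  ext g
  simp [mul_inv_eq_one]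

end nthZariski

/-- `1` is not a product `a₀x₁a₁⋯xₙaₙ` with `aᵢ ∈ Aᵢ` and `xⱼ ∈ X`. -/
def Separating {G : Type*} [Group G] {n : ℕ} (A : Fin (n + 1) → Set G) (X : Set G) : Prop :=
  ∀ (a : Fin (n + 1) → G) (x : Fin n → G), (∀ i, a i ∈ A i) → (∀ j, x j ∈ X) →
    (List.ofFn fun j : Fin n => a j.castSucc * x j).prod * a (Fin.last n) ≠ 1

namespace Separating

variable {G : Type*} [Group G] {n : ℕ} {A : Fin (n + 1) → Set G} {X : Set G}

theorem exists_notMem_union_pair (hn : 1 ≤ n) (hnd : nthZariski G n ≠ ⊥) (hA : ∀ i, (A i).Finite)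
    (hX : X.Finite) (hone : 1 ∈ X) (hsep : Separating A X) :
    ∃ g, g ∉ X ∧ Separating A (X ∪ {g, g⁻¹}) := by
  let := nthZariski G n
  let F : Set (G → G) := (fun x _ => x) '' X ∪ {fun g => g, fun g => g⁻¹}
  have hF : F.Finite := (hX.image _).union (by simp)
  have hFmon : ∀ φ ∈ F, IsMonomialMap 1 φ := by
    rintro φ (⟨x, -, rfl⟩ | rfl | rfl)
    exacts [.const x, .id, .inv]
  have hFone : ∀ φ ∈ F, φ 1 ∈ X := by
    rintro φ (⟨x, hx, rfl⟩ | rfl | rfl)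
    exacts [hx, hone, by simpa using hone]
  let word (p : (Fin (n + 1) → G) × (Fin n → G → G)) (g : G) : G :=
    (List.ofFn fun j : Fin n => p.1 j.castSucc * p.2 j g).prod * p.1 (Fin.last n)
  have hP : (Set.univ.pi A ×ˢ Set.univ.pi fun _ : Fin n => F).Finite :=
    (Set.Finite.pi hA).prod (Set.Finite.pi fun _ => hF)
  have hU : IsOpen ((⋂ p ∈ Set.univ.pi A ×ˢ Set.univ.pi fun _ : Fin n => F,
      {g | word p g ≠ 1}) ∩ ⋂ x ∈ X \ {1}, {g | g ≠ x}) := by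
    refine (hP.isOpen_biInter fun p hp => ?_).inter
      (hX.sdiff.isOpen_biInter fun x _ => isOpen_compl_singleton_nthZariski hn x)
    refine IsMonomialMap.isOpen_ne_one (IsMonomialMap.mul (m := 0) (.listProd fun j => ?_)
      (.const _))
    exact (IsMonomialMap.const (k := 0) _).mul (hFmon _ (hp.2 j trivial)) |>.mono (by simp)
  obtain ⟨g, hgU, hg⟩ : ∃ g ∈ (⋂ p ∈ Set.univ.pi A ×ˢ Set.univ.pi fun _ : Fin n => F,
      {g | word p g ≠ 1}) ∩ ⋂ x ∈ X \ {1}, {g | g ≠ x}, g ≠ 1 := by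
    by_contra! h
    refine not_isOpen_singleton_one_nthZariski hnd ?_
    convert hU using 1
    refine (Set.Subset.antisymm h ?_).symm
    rintro _ rfl
    refine ⟨Set.mem_iInter₂.2 fun p hp => ?_, Set.mem_iInter₂.2 fun x hx => Ne.symm hx.2⟩
    exact hsep p.1 (fun j => p.2 j 1) (fun i => hp.1 i trivial)
      fun j => hFone _ (hp.2 j trivial)
  refine ⟨g, fun hgX => Set.mem_iInter₂.1 hgU.2 g ⟨hgX, hg⟩ rfl, fun a x ha hx => ?_⟩
  have hφ : ∀ j, ∃ φ ∈ F, φ g = x j := fun j => by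
    rcases hx j with h | h | h
    · exact ⟨_, .inl ⟨x j, h, rfl⟩, rfl⟩
    · exact ⟨fun g => g, by simp [F], h.symm⟩
    · exact ⟨fun g => g⁻¹, by simp [F], h.symm⟩
  choose φ hφF hφ using hφ
  simpa [word, hφ] using Set.mem_iInter₂.1 hgU.1 (a, φ) ⟨fun i _ => ha i, fun j _ => hφF j⟩

theorem sUnion {c : Set (Set G)} (hc : IsChain (· ⊆ ·) c) (hne : c.Nonempty)
    (h : ∀ X ∈ c, Separating A X) : Separating A (⋃₀ c) := by
  intro a x ha hx
  obtain ⟨X, hXc, hX⟩ := hc.directedOn.exists_mem_subset_of_finite_of_subset_sUnion hne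
    (Set.finite_range x) (Set.range_subset_iff.2 hx)
  exact h X hXc a x ha fun j => hX ⟨j, rfl⟩

end Separating

/-- If the `n`-th Zariski topology on `G` (`n ≥ 1`) is non-discrete, then for all finite
subsets `A₀, …, Aₙ ⊆ G` with `1 ∉ A₀A₁⋯Aₙ` there is an infinite symmetric subset
`X ∋ 1` of `G` with `1 ∉ A₀XA₁X⋯XAₙ`. -/
theorem exists_infinite_symmetric_separating {G : Type*} [Group G]
    (n : ℕ) (hn : 1 ≤ n) (hnd : nthZariski G n ≠ ⊥)
    (A : Fin (n + 1) → Set G) (hA : ∀ i, (A i).Finite)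
    (h1 : ¬ ∃ a : Fin (n + 1) → G, (∀ i, a i ∈ A i) ∧
      (List.ofFn fun i => a i).prod = 1) :
    ∃ X : Set G, X.Infinite ∧ X⁻¹ = X ∧ (1 : G) ∈ X ∧
      ¬ ∃ (a : Fin (n + 1) → G) (x : Fin n → G),
        (∀ i, a i ∈ A i) ∧ (∀ j, x j ∈ X) ∧
        (List.ofFn fun j : Fin n => a j.castSucc * x j).prod * a (Fin.last n) = 1 := by
  have h₁ : Separating A {1} := by
    intro a x ha hx h
    refine h1 ⟨a, ha, ?_⟩
    rw [List.ofFn_succ']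
    simpa [Set.mem_singleton_iff.1 (hx _), List.prod_append] using h
  obtain ⟨X, -, hX⟩ : ∃ X, {1} ⊆ X ∧
      Maximal (· ∈ {X : Set G | X⁻¹ = X ∧ 1 ∈ X ∧ Separating A X}) X := by
    refine zorn_subset_nonempty _ (fun c hcS hc hne => ?_) {1} ⟨by simp, rfl, h₁⟩
    refine ⟨⋃₀ c, ⟨?_, ?_, .sUnion hc hne fun X hX => (hcS hX).2.2⟩,
      fun _ => Set.subset_sUnion_of_mem⟩
    · ext g
      simp only [Set.mem_inv, Set.mem_sUnion]
      refine exists_congr fun X => and_congr_right fun hX => ?_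
      rw [← Set.mem_inv, (hcS hX).1]
    · obtain ⟨X, hX⟩ := hne
      exact ⟨X, hX, (hcS hX).2.1⟩
  obtain ⟨hsymm, hone, hsep⟩ := hX.prop
  refine ⟨X, fun hfin => ?_, hsymm, hone, fun ⟨a, x, ha, hx, h⟩ => hsep a x ha hx h⟩
  obtain ⟨g, hgX, hg⟩ := hsep.exists_notMem_union_pair hn hnd hA hfin hone
  refine hgX (hX.le_of_ge ⟨?_, .inl hone, hg⟩ Set.subset_union_left (by simp))
  rw [Set.union_inv, hsymm, Set.inv_insert, Set.inv_singleton, inv_inv, Set.pair_comm]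
end
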